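/- arXiv:1406.1995 — 3 statements merged into one kernel-verified Lean document; each statement's English description precedes it below -/
import Mathlib

section
/- Let M = (0,1)² and Ω = M × (−h, h). There is a constant C (depending only on h) such that for all measurable functions φ, ψ on Ω with φ, ∇_H φ, ψ, ∇_H ψ ∈ L²(Ω) and φ(·,z) ∈ L⁴(M) for a.e. z, the following holds: ∫_M (∫_{−h}^h |φ| dz)(∫_{−h}^h |φ_2 ψ| dz) dx dy ≤ C ‖φ‖₂^{1/2}(‖φ‖₂^{1/2} + ‖∇_H φ‖₂^{1/2}) ‖φ₂‖₂ ‖ψ‖₂^{1/2}(‖ψ‖₂^{1/2} + ‖∇_H ψ‖₂^{1/2}), for any φ₂ ∈ L²(Ω). Here ∇_H = (∂_x, ∂_y) and ‖·‖₂ is the L²(Ω) norm. -/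
open MeasureTheory Real Set

noncomputable section

/-- The unit square `M = (0,1)²`. -/
def sqM : Set (ℝ × ℝ) := Set.Ioo 0 1 ×ˢ Set.Ioo 0 1

/-- The domain `Ω = M × (−h,h)`. -/
def Omg (h : ℝ) : Set (ℝ × ℝ × ℝ) := Set.Ioo 0 1 ×ˢ Set.Ioo 0 1 ×ˢ Set.Ioo (-h) h

/-- Horizontal partial derivatives. -/
def dX (f : ℝ × ℝ × ℝ → ℝ) (p : ℝ × ℝ × ℝ) : ℝ := fderiv ℝ f p (1, 0, 0)
def dY (f : ℝ × ℝ × ℝ → ℝ) (p : ℝ × ℝ × ℝ) : ℝ := fderiv ℝ f p (0, 1, 0)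

/-- The pointwise norm `|∇_H f|` of the horizontal gradient. -/
def gradHnorm (f : ℝ × ℝ × ℝ → ℝ) (p : ℝ × ℝ × ℝ) : ℝ :=
  Real.sqrt ((dX f p) ^ 2 + (dY f p) ^ 2)

/-- The `L²(Ω)` norm. -/
def L2 (h : ℝ) (f : ℝ × ℝ × ℝ → ℝ) : ℝ := (∫ p in Omg h, (f p) ^ 2) ^ ((1 : ℝ) / 2)

/-- Cauchy–Schwarz for the lower Lebesgue integral. -/
theorem lintegral_mul_le_sqrt_mul_sqrt {α : Type*} [MeasurableSpace α] (μ : Measure α)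
    {f g : α → ENNReal} (hf : AEMeasurable f μ) (hg : AEMeasurable g μ) :
    ∫⁻ a, f a * g a ∂μ ≤
      (∫⁻ a, f a ^ 2 ∂μ) ^ ((1 : ℝ) / 2) * (∫⁻ a, g a ^ 2 ∂μ) ^ ((1 : ℝ) / 2) := by
  simpa using ENNReal.lintegral_mul_le_Lp_mul_Lq μ Real.HolderConjugate.two_two hf hg

/-- An a.e.-measurable function has a measurable majorant that agrees with it a.e. -/
theorem AEMeasurable.exists_measurable_ge_ae_eq {α : Type*} [MeasurableSpace α] {μ : Measure α}
    {f : α → ENNReal} (hf : AEMeasurable f μ) :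
    ∃ g : α → ENNReal, Measurable g ∧ f ≤ g ∧ f =ᵐ[μ] g := by
  classical
  have hnull : μ {a | ¬ f a = hf.mk f a} = 0 := hf.ae_eq_mk
  set t := toMeasurable μ {a | ¬ f a = hf.mk f a}
  have ht : μ t = 0 := by rw [measure_toMeasurable, hnull]
  have hft : ∀ a, a ∉ t → f a = hf.mk f a := fun a ha => by
    by_contra hne
    exact ha (subset_toMeasurable _ _ hne)
  refine ⟨t.piecewise (fun _ => ⊤) (hf.mk f),
    Measurable.piecewise (measurableSet_toMeasurable _ _) measurable_const hf.measurable_mk,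
    fun a => ?_, ?_⟩
  · by_cases ha : a ∈ t
    · simp [ha]
    · simp [ha, hft a ha]
  · filter_upwards [measure_eq_zero_iff_ae_notMem.1 ht] with a ha
    simp [ha, hft a ha]

/-- Pointwise bound of `f ^ 2` on the unit interval by its `W^{1,1}` norm. -/
theorem enorm_sq_le_lintegral_of_hasDerivAt {f f' : ℝ → ℝ} (hf : ∀ x, HasDerivAt f (f' x) x)
    {x : ℝ} (hx : x ∈ Ioo (0 : ℝ) 1) :
    ‖f x‖ₑ ^ 2 ≤ ∫⁻ t in Ioo (0 : ℝ) 1, (‖f t‖ₑ ^ 2 + 2 * (‖f t‖ₑ * ‖f' t‖ₑ)) := by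
  have hfm : Measurable f :=
    (continuous_iff_continuousAt.2 fun t => (hf t).continuousAt).measurable
  have hf'm : Measurable f' := by
    rw [show f' = deriv f from funext fun t => (hf t).deriv.symm]
    exact measurable_deriv f
  set J := ∫⁻ t in Ioo (0 : ℝ) 1, 2 * (‖f t‖ₑ * ‖f' t‖ₑ)
  rw [lintegral_add_left (by fun_prop)]
  by_cases hJ : J = ⊤
  · simp [J, hJ]
  have hg : ∀ t, HasDerivAt (fun t => f t ^ 2) (2 * (f t * f' t)) t := fun t =>
    ((hf t).pow 2).congr_deriv (by push_cast; ring)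
  have henorm : ∀ t, ‖2 * (f t * f' t)‖ₑ = 2 * (‖f t‖ₑ * ‖f' t‖ₑ) := fun t => by
    rw [enorm_mul, enorm_mul]
    congr 1
    simp [Real.enorm_eq_ofReal_abs]
  have hint : IntegrableOn (fun t => 2 * (f t * f' t)) (Ioo 0 1) := by
    refine ⟨by fun_prop, ?_⟩
    simp only [HasFiniteIntegral, henorm]
    exact lt_top_iff_ne_top.2 hJ
  have hstep : ∀ s ∈ Ioo (0 : ℝ) 1, ‖f x‖ₑ ^ 2 ≤ ‖f s‖ₑ ^ 2 + J := by
    intro s hs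
    have hsub : uIoc s x ⊆ Ioo 0 1 :=
      uIoc_subset_uIcc.trans (Set.OrdConnected.uIcc_subset inferInstance hs hx)
    have hftc := intervalIntegral.integral_eq_sub_of_hasDerivAt (fun t _ => hg t)
      (intervalIntegrable_iff.2 (hint.mono_set hsub))
    have hbound : ‖f x ^ 2 - f s ^ 2‖ₑ ≤ J := by
      rw [← hftc, ← ofReal_norm, intervalIntegral.norm_intervalIntegral_eq, ofReal_norm]
      refine (enorm_integral_le_lintegral_enorm _).trans ?_
      simp only [henorm]
      exact lintegral_mono_set hsub
    calc ‖f x‖ₑ ^ 2 = ‖f s ^ 2 + (f x ^ 2 - f s ^ 2)‖ₑ := by rw [← enorm_pow]; congr 1; ring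
      _ ≤ ‖f s ^ 2‖ₑ + ‖f x ^ 2 - f s ^ 2‖ₑ := enorm_add_le _ _
      _ ≤ ‖f s‖ₑ ^ 2 + J := by rw [enorm_pow]; gcongr
  calc ‖f x‖ₑ ^ 2 = ∫⁻ _ in Ioo (0 : ℝ) 1, ‖f x‖ₑ ^ 2 := by simp
    _ ≤ ∫⁻ s in Ioo (0 : ℝ) 1, (‖f s‖ₑ ^ 2 + J) := setLIntegral_mono' measurableSet_Ioo hstep
    _ = _ := by rw [lintegral_add_left (by fun_prop)]; simp [J]

/-- Cauchy–Schwarz in `z` and then in `(x, y)`, when the squares of `p` and `q` are dominated by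
functions not depending on `x` and `y` respectively. -/
theorem lintegral_lintegral_mul_lintegral_le {α β γ : Type*} [MeasurableSpace α]
    [MeasurableSpace β] [MeasurableSpace γ] (μ : Measure α) (ν : Measure β) (ρ : Measure γ)
    [SFinite μ] [SFinite ν] [SFinite ρ] {p q k : α × β × γ → ENNReal} {G : β × γ → ENNReal}
    {H : α × γ → ENNReal} (hp : Measurable p) (hq : Measurable q) (hk : Measurable k)
    (hG : Measurable G) (hH : Measurable H)
    (hpG : ∀ᵐ a ∂(μ.prod ν), ∀ c, p (a.1, a.2, c) ^ 2 ≤ G (a.2, c))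
    (hqH : ∀ᵐ a ∂(μ.prod ν), ∀ c, q (a.1, a.2, c) ^ 2 ≤ H (a.1, c)) :
    ∫⁻ a, (∫⁻ c, p (a.1, a.2, c) ∂ρ) * (∫⁻ c, k (a.1, a.2, c) * q (a.1, a.2, c) ∂ρ) ∂(μ.prod ν) ≤
      ρ univ ^ ((1 : ℝ) / 2) * (∫⁻ v, k v ^ 2 ∂(μ.prod (ν.prod ρ))) ^ ((1 : ℝ) / 2) *
        ((∫⁻ v, G v ∂(ν.prod ρ)) ^ ((1 : ℝ) / 2) * (∫⁻ v, H v ∂(μ.prod ρ)) ^ ((1 : ℝ) / 2)) := by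
  have hKm : Measurable fun a : α × β => ∫⁻ c, k (a.1, a.2, c) ^ 2 ∂ρ :=
    Measurable.lintegral_prod_right' (f := fun w : (α × β) × γ => k (w.1.1, w.1.2, w.2) ^ 2)
      (by fun_prop)
  have hgm : Measurable fun b => ∫⁻ c, G (b, c) ∂ρ := hG.lintegral_prod_right'
  have hhm : Measurable fun a => ∫⁻ c, H (a, c) ∂ρ := hH.lintegral_prod_right'
  have hsq : ∀ t : ENNReal, (t ^ ((1 : ℝ) / 2)) ^ 2 = t := fun t => by
    rw [← ENNReal.rpow_natCast, ← ENNReal.rpow_mul]; norm_num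
  calc _ ≤ ∫⁻ a, ρ univ ^ ((1 : ℝ) / 2) * ((∫⁻ c, k (a.1, a.2, c) ^ 2 ∂ρ) ^ ((1 : ℝ) / 2) *
        ((∫⁻ c, H (a.1, c) ∂ρ) * (∫⁻ c, G (a.2, c) ∂ρ)) ^ ((1 : ℝ) / 2)) ∂(μ.prod ν) := by
        refine lintegral_mono_ae ?_
        filter_upwards [hpG, hqH] with a ha hb
        have h1 : ∫⁻ c, p (a.1, a.2, c) ∂ρ ≤
            ρ univ ^ ((1 : ℝ) / 2) * (∫⁻ c, G (a.2, c) ∂ρ) ^ ((1 : ℝ) / 2) := by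
          have := lintegral_mul_le_sqrt_mul_sqrt ρ (f := fun _ => 1)
            (g := fun c => p (a.1, a.2, c)) (by fun_prop) (by fun_prop)
          simp only [one_mul, one_pow, lintegral_one] at this
          refine this.trans ?_
          gcongr with c
          exact ha c
        have h2 : ∫⁻ c, k (a.1, a.2, c) * q (a.1, a.2, c) ∂ρ ≤
            (∫⁻ c, k (a.1, a.2, c) ^ 2 ∂ρ) ^ ((1 : ℝ) / 2) *
              (∫⁻ c, H (a.1, c) ∂ρ) ^ ((1 : ℝ) / 2) := by
          refine (lintegral_mul_le_sqrt_mul_sqrt ρ (f := fun c => k (a.1, a.2, c))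
            (g := fun c => q (a.1, a.2, c)) (by fun_prop) (by fun_prop)).trans ?_
          gcongr with c
          exact hb c
        refine (mul_le_mul' h1 h2).trans (le_of_eq ?_)
        rw [ENNReal.mul_rpow_of_nonneg _ _ (by norm_num)]
        ring
    _ ≤ ρ univ ^ ((1 : ℝ) / 2) * ((∫⁻ a, ∫⁻ c, k (a.1, a.2, c) ^ 2 ∂ρ ∂(μ.prod ν)) ^ ((1 : ℝ) / 2) *
        (∫⁻ a, (∫⁻ c, H (a.1, c) ∂ρ) * (∫⁻ c, G (a.2, c) ∂ρ) ∂(μ.prod ν)) ^ ((1 : ℝ) / 2)) := by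
        rw [lintegral_const_mul _ (by fun_prop)]
        gcongr
        refine (lintegral_mul_le_sqrt_mul_sqrt _ (by fun_prop) (by fun_prop)).trans ?_
        simp only [hsq, le_refl]
    _ = _ := by
        rw [lintegral_prod_mul hhm.aemeasurable hgm.aemeasurable,
          ENNReal.mul_rpow_of_nonneg _ _ (by norm_num), lintegral_prod _ hKm.aemeasurable,
          lintegral_prod _ hG.aemeasurable, lintegral_prod _ hH.aemeasurable,
          lintegral_prod (μ := μ) _ (by fun_prop)]
        have hk2 : ∀ x, ∫⁻ v, k (x, v) ^ 2 ∂(ν.prod ρ) = ∫⁻ y, ∫⁻ c, k (x, y, c) ^ 2 ∂ρ ∂ν :=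
          fun x => lintegral_prod _ (by fun_prop)
        simp only [hk2]
        ring

theorem volume_restrict_sqM :
    (volume.restrict sqM : Measure (ℝ × ℝ)) =
      (volume.restrict (Ioo 0 1)).prod (volume.restrict (Ioo 0 1)) := by
  rw [Measure.prod_restrict]; rfl

theorem volume_restrict_Omg (h : ℝ) :
    (volume.restrict (Omg h) : Measure (ℝ × ℝ × ℝ)) =
      (volume.restrict (Ioo 0 1)).prod
        ((volume.restrict (Ioo 0 1)).prod (volume.restrict (Ioo (-h) h))) := by
  rw [Measure.prod_restrict, Measure.prod_restrict]; rfl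

theorem measurable_gradHnorm (f : ℝ × ℝ × ℝ → ℝ) : Measurable (gradHnorm f) := by
  have h1 : Measurable (dX f) := measurable_fderiv_apply_const ℝ f _
  have h2 : Measurable (dY f) := measurable_fderiv_apply_const ℝ f _
  unfold gradHnorm
  fun_prop

theorem enorm_dX_le (f : ℝ × ℝ × ℝ → ℝ) (p : ℝ × ℝ × ℝ) : ‖dX f p‖ₑ ≤ ‖gradHnorm f p‖ₑ := by
  rw [enorm_le_iff_norm_le, gradHnorm, Real.norm_of_nonneg (Real.sqrt_nonneg _)]
  exact Real.abs_le_sqrt (le_add_of_nonneg_right (sq_nonneg _))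

theorem enorm_dY_le (f : ℝ × ℝ × ℝ → ℝ) (p : ℝ × ℝ × ℝ) : ‖dY f p‖ₑ ≤ ‖gradHnorm f p‖ₑ := by
  rw [enorm_le_iff_norm_le, gradHnorm, Real.norm_of_nonneg (Real.sqrt_nonneg _)]
  exact Real.abs_le_sqrt (le_add_of_nonneg_left (sq_nonneg _))

theorem L2_nonneg (h : ℝ) (f : ℝ × ℝ × ℝ → ℝ) : 0 ≤ L2 h f :=
  Real.rpow_nonneg (integral_nonneg fun _ => sq_nonneg _) _

theorem lintegral_enorm_sq_rpow_eq_ofReal_L2 {h : ℝ} {f : ℝ × ℝ × ℝ → ℝ}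
    (hf : IntegrableOn (fun p => f p ^ 2) (Omg h) volume) :
    (∫⁻ p in Omg h, ‖f p‖ₑ ^ 2) ^ ((1 : ℝ) / 2) = ENNReal.ofReal (L2 h f) := by
  rw [L2, ← ENNReal.ofReal_rpow_of_nonneg (integral_nonneg fun _ => sq_nonneg _) (by norm_num),
    ofReal_integral_eq_lintegral_ofReal hf (ae_of_all _ fun _ => sq_nonneg _)]
  congr 1
  refine lintegral_congr fun p => ?_
  rw [Real.enorm_eq_ofReal_abs, ← ENNReal.ofReal_pow (abs_nonneg _), sq_abs]

/-- Density whose integral along a horizontal unit segment dominates `|f|²` on that segment. -/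
def horizontalDensity (f : ℝ × ℝ × ℝ → ℝ) (p : ℝ × ℝ × ℝ) : ENNReal :=
  ‖f p‖ₑ ^ 2 + 2 * (‖f p‖ₑ * ‖gradHnorm f p‖ₑ)

theorem measurable_horizontalDensity {f : ℝ × ℝ × ℝ → ℝ} (hf : Measurable f) :
    Measurable (horizontalDensity f) := by
  have := measurable_gradHnorm f
  unfold horizontalDensity
  fun_prop

theorem enorm_sq_le_lintegral_fst {f : ℝ × ℝ × ℝ → ℝ} (hf : Differentiable ℝ f) {x : ℝ}
    (hx : x ∈ Ioo (0 : ℝ) 1) (y z : ℝ) :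
    ‖f (x, y, z)‖ₑ ^ 2 ≤ ∫⁻ t in Ioo (0 : ℝ) 1, horizontalDensity f (t, y, z) := by
  have hd : ∀ t, HasDerivAt (fun t => f (t, y, z)) (dX f (t, y, z)) t := fun t =>
    (hf (t, y, z)).hasFDerivAt.comp_hasDerivAt t
      ((hasDerivAt_id t).prodMk ((hasDerivAt_const t y).prodMk (hasDerivAt_const t z)))
  refine (enorm_sq_le_lintegral_of_hasDerivAt hd hx).trans (lintegral_mono fun t => ?_)
  unfold horizontalDensity
  gcongr
  exact enorm_dX_le _ _

theorem enorm_sq_le_lintegral_snd {f : ℝ × ℝ × ℝ → ℝ} (hf : Differentiable ℝ f) {y : ℝ}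
    (hy : y ∈ Ioo (0 : ℝ) 1) (x z : ℝ) :
    ‖f (x, y, z)‖ₑ ^ 2 ≤ ∫⁻ t in Ioo (0 : ℝ) 1, horizontalDensity f (x, t, z) := by
  have hd : ∀ t, HasDerivAt (fun t => f (x, t, z)) (dY f (x, t, z)) t := fun t =>
    (hf (x, t, z)).hasFDerivAt.comp_hasDerivAt t
      ((hasDerivAt_const t x).prodMk ((hasDerivAt_id t).prodMk (hasDerivAt_const t z)))
  refine (enorm_sq_le_lintegral_of_hasDerivAt hd hy).trans (lintegral_mono fun t => ?_)
  unfold horizontalDensity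
  gcongr
  exact enorm_dY_le _ _

theorem lintegral_horizontalDensity_rpow_le {h : ℝ} {f : ℝ × ℝ × ℝ → ℝ} (hf : Measurable f)
    (hf2 : IntegrableOn (fun p => f p ^ 2) (Omg h) volume)
    (hg2 : IntegrableOn (fun p => gradHnorm f p ^ 2) (Omg h) volume) :
    (∫⁻ p in Omg h, horizontalDensity f p) ^ ((1 : ℝ) / 2) ≤
      ENNReal.ofReal (2 * ((L2 h f) ^ ((1 : ℝ) / 2) *
        ((L2 h f) ^ ((1 : ℝ) / 2) + (L2 h (gradHnorm f)) ^ ((1 : ℝ) / 2)))) := by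
  have hgm := measurable_gradHnorm f
  set N := L2 h f
  set D := L2 h (gradHnorm f)
  have hN : 0 ≤ N := L2_nonneg h f
  have hD : 0 ≤ D := L2_nonneg h _
  have hsq : ∫⁻ p in Omg h, ‖f p‖ₑ ^ 2 = ENNReal.ofReal N ^ 2 := by
    rw [← lintegral_enorm_sq_rpow_eq_ofReal_L2 hf2, ← ENNReal.rpow_natCast, ← ENNReal.rpow_mul]
    norm_num
  have hle : ∫⁻ p in Omg h, horizontalDensity f p ≤ ENNReal.ofReal (N * (N + 2 * D)) := by
    unfold horizontalDensity
    rw [lintegral_add_left (by fun_prop), lintegral_const_mul _ (by fun_prop), hsq]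
    have hcs := lintegral_mul_le_sqrt_mul_sqrt (volume.restrict (Omg h))
      (f := fun p => ‖f p‖ₑ) (g := fun p => ‖gradHnorm f p‖ₑ) (by fun_prop) (by fun_prop)
    rw [lintegral_enorm_sq_rpow_eq_ofReal_L2 hf2, lintegral_enorm_sq_rpow_eq_ofReal_L2 hg2] at hcs
    calc _ ≤ ENNReal.ofReal N ^ 2 + 2 * (ENNReal.ofReal N * ENNReal.ofReal D) := by gcongr
      _ = _ := by
        rw [ENNReal.ofReal_mul hN, ENNReal.ofReal_add hN (by positivity),
          ENNReal.ofReal_mul (by norm_num), ENNReal.ofReal_ofNat]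
        ring
  refine (ENNReal.rpow_le_rpow hle (by norm_num)).trans ?_
  rw [ENNReal.ofReal_rpow_of_nonneg (by positivity) (by norm_num)]
  refine ENNReal.ofReal_le_ofReal ?_
  simp only [← Real.sqrt_eq_rpow]
  refine Real.sqrt_le_iff.2 ⟨by positivity, ?_⟩
  have hsN := Real.sq_sqrt hN
  have hsD := Real.sq_sqrt hD
  have hmul : 0 ≤ N * (√N * √D) := by positivity
  calc N * (N + 2 * D) ≤ 4 * N * (N + D + 2 * (√N * √D)) := by
        nlinarith [mul_nonneg hN hN, mul_nonneg hN hD]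
    _ = 4 * √N ^ 2 * (√N ^ 2 + √D ^ 2 + 2 * (√N * √D)) := by rw [hsN, hsD]
    _ = _ := by ring

/-- Anisotropic Ladyzhenskaya-type inequality in 3D:
`∫_M (∫|φ|dz)(∫|φ₂ψ|dz) ≤ C‖φ‖₂^{1/2}(‖φ‖₂^{1/2}+‖∇_Hφ‖₂^{1/2})‖φ₂‖₂‖ψ‖₂^{1/2}(‖ψ‖₂^{1/2}+‖∇_Hψ‖₂^{1/2})`. -/
theorem stmt_7 (h : ℝ) (hh : 0 < h) :
    ∃ C > 0, ∀ φ ψ φ₂ : ℝ × ℝ × ℝ → ℝ,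
      Differentiable ℝ φ → Differentiable ℝ ψ →
      IntegrableOn (fun p => (φ p) ^ 2) (Omg h) volume →
      IntegrableOn (fun p => (gradHnorm φ p) ^ 2) (Omg h) volume →
      IntegrableOn (fun p => (ψ p) ^ 2) (Omg h) volume →
      IntegrableOn (fun p => (gradHnorm ψ p) ^ 2) (Omg h) volume →
      IntegrableOn (fun p => (φ₂ p) ^ 2) (Omg h) volume →
      (∀ᵐ z ∂(volume.restrict (Set.Ioo (-h) h)),
        IntegrableOn (fun xy : ℝ × ℝ => |φ (xy.1, xy.2, z)| ^ 4) sqM volume) →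
      (∫ xy in sqM, (∫ z in Set.Ioo (-h) h, |φ (xy.1, xy.2, z)|) *
          (∫ z in Set.Ioo (-h) h, |φ₂ (xy.1, xy.2, z) * ψ (xy.1, xy.2, z)|)) ≤
        C * (L2 h φ) ^ ((1 : ℝ) / 2) *
          ((L2 h φ) ^ ((1 : ℝ) / 2) + (L2 h (gradHnorm φ)) ^ ((1 : ℝ) / 2)) *
          L2 h φ₂ *
          (L2 h ψ) ^ ((1 : ℝ) / 2) *
          ((L2 h ψ) ^ ((1 : ℝ) / 2) + (L2 h (gradHnorm ψ)) ^ ((1 : ℝ) / 2)) := by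
  refine ⟨4 * (2 * h) ^ ((1 : ℝ) / 2), by positivity, ?_⟩
  intro φ ψ φ₂ hφ hψ hφ2 hφg hψ2 hψg hφ₂ _
  have hφm : Measurable φ := hφ.continuous.measurable
  have hψm : Measurable ψ := hψ.continuous.measurable
  have hφ₂m : AEMeasurable (fun p => ‖φ₂ p‖ₑ) (volume.restrict (Omg h)) := by
    have : (fun p => ‖φ₂ p‖ₑ) = fun p => ENNReal.ofReal (√(φ₂ p ^ 2)) := by
      ext p; rw [Real.sqrt_sq_eq_abs, Real.enorm_eq_ofReal_abs]
    rw [this]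
    exact (hφ₂.aestronglyMeasurable.aemeasurable.sqrt).ennreal_ofReal
  obtain ⟨k, hkm, hk, hkae⟩ := hφ₂m.exists_measurable_ge_ae_eq
  have hk2 : (∫⁻ p in Omg h, k p ^ 2) ^ ((1 : ℝ) / 2) = ENNReal.ofReal (L2 h φ₂) := by
    rw [← lintegral_enorm_sq_rpow_eq_ofReal_L2 hφ₂]
    congr 1
    refine lintegral_congr_ae ?_
    filter_upwards [hkae] with p hp
    rw [hp]
  set μ : Measure ℝ := volume.restrict (Ioo 0 1)
  set ν : Measure ℝ := volume.restrict (Ioo (-h) h)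
  have hFφ := measurable_horizontalDensity hφm
  have hFψ := measurable_horizontalDensity hψm
  have hmem : ∀ᵐ a ∂(μ.prod μ), a ∈ sqM := by
    rw [← volume_restrict_sqM]
    exact ae_restrict_mem (measurableSet_Ioo.prod measurableSet_Ioo)
  have key := lintegral_lintegral_mul_lintegral_le μ μ ν (p := fun p => ‖φ p‖ₑ)
    (q := fun p => ‖ψ p‖ₑ) (k := k) (G := fun v => ∫⁻ t, horizontalDensity φ (t, v) ∂μ)
    (H := fun v => ∫⁻ t, horizontalDensity ψ (v.1, t, v.2) ∂μ)
    (by fun_prop) (by fun_prop) hkm hFφ.lintegral_prod_left'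
    (Measurable.lintegral_prod_right'
      (f := fun w : (ℝ × ℝ) × ℝ => horizontalDensity ψ (w.1.1, w.2, w.1.2)) (by fun_prop))
    (by filter_upwards [hmem] with a ha c using enorm_sq_le_lintegral_fst hφ ha.1 _ _)
    (by filter_upwards [hmem] with a ha c using enorm_sq_le_lintegral_snd hψ ha.2 _ _)
  have hG : ∫⁻ v, ∫⁻ t, horizontalDensity φ (t, v) ∂μ ∂(μ.prod ν) =
      ∫⁻ p in Omg h, horizontalDensity φ p := by
    rw [volume_restrict_Omg, lintegral_prod_symm' _ hFφ]
  have hH : ∫⁻ v, ∫⁻ t, horizontalDensity ψ (v.1, t, v.2) ∂μ ∂(μ.prod ν) =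
      ∫⁻ p in Omg h, horizontalDensity ψ p := by
    rw [volume_restrict_Omg, lintegral_prod _ hFψ.aemeasurable,
      lintegral_prod _ (Measurable.lintegral_prod_right'
        (f := fun w : (ℝ × ℝ) × ℝ => horizontalDensity ψ (w.1.1, w.2, w.1.2))
        (by fun_prop)).aemeasurable]
    refine lintegral_congr fun x => ?_
    rw [lintegral_prod_symm' _ (by fun_prop)]
  have hν : ν univ = ENNReal.ofReal (2 * h) := by
    simp only [ν, Measure.restrict_apply_univ, Real.volume_Ioo]
    congr 1; ring
  rw [hG, hH, ← volume_restrict_Omg, hk2, hν,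
    ENNReal.ofReal_rpow_of_nonneg (by positivity) (by norm_num)] at key
  have hNφ := L2_nonneg h φ
  have hNψ := L2_nonneg h ψ
  have hNφ₂ := L2_nonneg h φ₂
  have hDφ := L2_nonneg h (gradHnorm φ)
  have hDψ := L2_nonneg h (gradHnorm ψ)
  refine (ENNReal.ofReal_le_ofReal_iff (by positivity)).1 ?_
  calc _ ≤ ∫⁻ a in sqM, (∫⁻ c, ‖φ (a.1, a.2, c)‖ₑ ∂ν) *
        (∫⁻ c, k (a.1, a.2, c) * ‖ψ (a.1, a.2, c)‖ₑ ∂ν) := by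
        refine (Real.ofReal_le_enorm _).trans
          ((enorm_integral_le_lintegral_enorm _).trans (lintegral_mono fun a => ?_))
        rw [enorm_mul]
        refine mul_le_mul' ((enorm_integral_le_lintegral_enorm _).trans ?_)
          ((enorm_integral_le_lintegral_enorm _).trans (lintegral_mono fun c => ?_))
        · simp only [enorm_abs, le_refl, ν]
        · rw [enorm_abs, enorm_mul]
          gcongr
          exact hk _
    _ ≤ _ := by rw [volume_restrict_sqM]; exact key
    _ ≤ _ := mul_le_mul' le_rfl (mul_le_mul' (lintegral_horizontalDensity_rpow_le hφm hφ2 hφg)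
        (lintegral_horizontalDensity_rpow_le hψm hψ2 hψg))
    _ = _ := by
        rw [← ENNReal.ofReal_mul (by positivity), ← ENNReal.ofReal_mul (by positivity),
          ← ENNReal.ofReal_mul (by positivity)]
        congr 1
        ring
end
end

section
/- Let p_s¹ solve, on the periodic unit square M, the problem −Δ_H p_s¹ = div_H div_H ( (1/(2h)) ∫_{−h}^h v ⊗ v dz ) with ∫_M p_s¹ dx dy = 0, where v : M × (−h,h) → ℝ² is periodic. Then for every q ∈ (1,∞) there is C_q with ‖p_s¹‖_{L^q(M)} ≤ C_q ∫_{−h}^h ‖v(·,z)‖_{L^{2q}(M)}² dz, and ‖∇_H p_s¹‖_{L²(M)} ≤ C ‖ |v| |∇_H v| ‖_{L²(Ω)}. -/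
open MeasureTheory Real Set intervalIntegral

noncomputable section

def d2X (f : ℝ × ℝ → ℝ) (p : ℝ × ℝ) : ℝ := fderiv ℝ f p (1, 0)
def d2Y (f : ℝ × ℝ → ℝ) (p : ℝ × ℝ) : ℝ := fderiv ℝ f p (0, 1)

/-- The vertical average `(1/(2h)) ∫_{−h}^h f g dz` as a function on `M`. -/
def avg (h : ℝ) (f g : ℝ × ℝ × ℝ → ℝ) (xy : ℝ × ℝ) : ℝ :=
  (1 / (2 * h)) * ∫ z in (-h)..h, f (xy.1, xy.2, z) * g (xy.1, xy.2, z)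

/-- The hypotheses on the surface pressure component `ps1` generated by the
Reynolds-type term: `−Δ_H ps1 = div_H div_H ((1/2h)∫ v⊗v dz)`, zero mean, periodicity. -/
def Hyp15 (h : ℝ) (v1 v2 : ℝ × ℝ × ℝ → ℝ) (ps1 : ℝ × ℝ → ℝ) : Prop :=
  ContDiff ℝ (⊤ : ℕ∞) v1 ∧ ContDiff ℝ (⊤ : ℕ∞) v2 ∧ ContDiff ℝ (⊤ : ℕ∞) ps1 ∧
  (∀ x y z : ℝ, v1 (x + 1, y, z) = v1 (x, y, z) ∧ v1 (x, y + 1, z) = v1 (x, y, z)) ∧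
  (∀ x y z : ℝ, v2 (x + 1, y, z) = v2 (x, y, z) ∧ v2 (x, y + 1, z) = v2 (x, y, z)) ∧
  (∀ x y : ℝ, ps1 (x + 1, y) = ps1 (x, y) ∧ ps1 (x, y + 1) = ps1 (x, y)) ∧
  (∀ xy : ℝ × ℝ,
    -(d2X (d2X ps1) xy + d2Y (d2Y ps1) xy) =
      d2X (d2X (avg h v1 v1)) xy + d2X (d2Y (avg h v1 v2)) xy +
      d2Y (d2X (avg h v2 v1)) xy + d2Y (d2Y (avg h v2 v2)) xy) ∧
  (∫ xy in sqM, ps1 xy) = 0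

lemma measurableSet_sqM : MeasurableSet sqM := measurableSet_Ioo.prod measurableSet_Ioo

lemma sqM_subset : sqM ⊆ Icc (0 : ℝ) 1 ×ˢ Icc (0 : ℝ) 1 :=
  prod_mono Ioo_subset_Icc_self Ioo_subset_Icc_self

lemma isCompact_unitSquare : IsCompact (Icc (0 : ℝ) 1 ×ˢ Icc (0 : ℝ) 1) :=
  isCompact_Icc.prod isCompact_Icc

lemma volume_sqM : volume sqM = 1 := by
  rw [sqM, Measure.volume_eq_prod, Measure.prod_prod]
  simp

instance isProbabilityMeasure_sqM : IsProbabilityMeasure (volume.restrict sqM) :=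
  ⟨by rw [Measure.restrict_apply_univ, volume_sqM]⟩

lemma Continuous.integrableOn_sqM {G : ℝ × ℝ → ℝ} (hG : Continuous G) : IntegrableOn G sqM :=
  (hG.continuousOn.integrableOn_compact isCompact_unitSquare).mono_set sqM_subset

lemma setIntegral_sqM {G : ℝ × ℝ → ℝ} (hG : Continuous G) :
    ∫ P in sqM, G P = ∫ x in (0 : ℝ)..1, ∫ y in (0 : ℝ)..1, G (x, y) := by
  rw [sqM, Measure.volume_eq_prod, setIntegral_prod]
  · rw [integral_of_le zero_le_one, integral_Ioc_eq_integral_Ioo]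
    refine setIntegral_congr_fun measurableSet_Ioo fun x _ => ?_
    rw [integral_of_le zero_le_one, integral_Ioc_eq_integral_Ioo]
  · exact hG.integrableOn_sqM

lemma setIntegral_sqM_symm {G : ℝ × ℝ → ℝ} (hG : Continuous G) :
    ∫ P in sqM, G P = ∫ y in (0 : ℝ)..1, ∫ x in (0 : ℝ)..1, G (x, y) := by
  rw [setIntegral_sqM hG]
  refine intervalIntegral_intervalIntegral_swap ?_
  exact (hG.continuousOn.integrableOn_compact (isCompact_uIcc.prod isCompact_uIcc)).mono_set
    (prod_mono uIoc_subset_uIcc uIoc_subset_uIcc)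

/-- A continuously differentiable function on the plane, `1`-periodic in both variables, together
with its two partial derivatives. -/
structure PerC1 (G Gx Gy : ℝ × ℝ → ℝ) : Prop where
  cont : Continuous G
  contx : Continuous Gx
  conty : Continuous Gy
  dx : ∀ x y, HasDerivAt (fun s => G (s, y)) (Gx (x, y)) x
  dy : ∀ x y, HasDerivAt (fun s => G (x, s)) (Gy (x, y)) y
  per : ∀ x y : ℝ, G (x + 1, y) = G (x, y) ∧ G (x, y + 1) = G (x, y)

namespace PerC1

variable {F Fx Fy G Gx Gy : ℝ × ℝ → ℝ}

lemma add (hF : PerC1 F Fx Fy) (hG : PerC1 G Gx Gy) :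
    PerC1 (fun P => F P + G P) (fun P => Fx P + Gx P) (fun P => Fy P + Gy P) where
  cont := hF.cont.add hG.cont
  contx := hF.contx.add hG.contx
  conty := hF.conty.add hG.conty
  dx x y := (hF.dx x y).add (hG.dx x y)
  dy x y := (hF.dy x y).add (hG.dy x y)
  per x y := by simp only [(hF.per x y).1, (hF.per x y).2, (hG.per x y).1, (hG.per x y).2, and_self]

lemma mul (hF : PerC1 F Fx Fy) (hG : PerC1 G Gx Gy) :
    PerC1 (fun P => F P * G P) (fun P => Fx P * G P + F P * Gx P)
      (fun P => Fy P * G P + F P * Gy P) where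
  cont := hF.cont.mul hG.cont
  contx := (hF.contx.mul hG.cont).add (hF.cont.mul hG.contx)
  conty := (hF.conty.mul hG.cont).add (hF.cont.mul hG.conty)
  dx x y := (hF.dx x y).mul (hG.dx x y)
  dy x y := (hF.dy x y).mul (hG.dy x y)
  per x y := by simp only [(hF.per x y).1, (hF.per x y).2, (hG.per x y).1, (hG.per x y).2, and_self]

lemma integral_dx (hG : PerC1 G Gx Gy) : ∫ P in sqM, Gx P = 0 := by
  rw [setIntegral_sqM_symm hG.contx]
  have h0 : ∀ y : ℝ, ∫ x in (0 : ℝ)..1, Gx (x, y) = 0 := fun y => by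
    rw [integral_eq_sub_of_hasDerivAt (fun x _ => hG.dx x y)
      ((hG.contx.comp (by fun_prop)).intervalIntegrable _ _)]
    have := (hG.per 0 y).1
    rw [zero_add] at this
    rw [this, sub_self]
  simp [h0]

lemma integral_dy (hG : PerC1 G Gx Gy) : ∫ P in sqM, Gy P = 0 := by
  rw [setIntegral_sqM hG.conty]
  have h0 : ∀ x : ℝ, ∫ y in (0 : ℝ)..1, Gy (x, y) = 0 := fun x => by
    rw [integral_eq_sub_of_hasDerivAt (fun y _ => hG.dy x y)
      ((hG.conty.comp (by fun_prop)).intervalIntegrable _ _)]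
    have := (hG.per x 0).2
    rw [zero_add] at this
    rw [this, sub_self]
  simp [h0]

/-- The divergence theorem on the periodic square. -/
lemma integral_div (hF : PerC1 F Fx Fy) (hG : PerC1 G Gx Gy) :
    ∫ P in sqM, (Fx P + Gy P) = 0 := by
  rw [integral_add hF.contx.integrableOn_sqM hG.conty.integrableOn_sqM, hF.integral_dx,
    hG.integral_dy, add_zero]

end PerC1

/-- Differentiation under the integral sign over the unit square. -/
lemma hasDerivAt_setIntegral_sqM {f f' : ℝ → ℝ × ℝ → ℝ} (hf : Continuous fun p : ℝ × ℝ × ℝ => f p.1 p.2)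
    (hf' : Continuous fun p : ℝ × ℝ × ℝ => f' p.1 p.2)
    (hd : ∀ t P, HasDerivAt (fun s => f s P) (f' t P) t) (t : ℝ) :
    HasDerivAt (fun s => ∫ P in sqM, f s P) (∫ P in sqM, f' t P) t := by
  obtain ⟨C, hC⟩ := ((isCompact_closedBall t 1).prod isCompact_unitSquare).exists_bound_of_continuousOn
    hf'.continuousOn
  refine (hasDerivAt_integral_of_dominated_loc_of_deriv_le (F := f) (F' := f') (bound := fun _ => C)
    (Metric.ball_mem_nhds t one_pos) ?_ ?_ ?_ ?_ ?_ ?_).2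
  · exact .of_forall fun s => (hf.comp (by fun_prop : Continuous fun P : ℝ × ℝ => (s, P))).aestronglyMeasurable
  · exact (hf.comp (by fun_prop : Continuous fun P : ℝ × ℝ => (t, P))).integrableOn_sqM
  · exact (hf'.comp (by fun_prop : Continuous fun P : ℝ × ℝ => (t, P))).aestronglyMeasurable
  · filter_upwards [ae_restrict_mem measurableSet_sqM] with P hP s hs
    exact hC (s, P) ⟨Metric.ball_subset_closedBall hs, sqM_subset hP⟩
  · exact integrable_const C
  · exact .of_forall fun P s _ => hd s P

/-- The data of a heat mode `c e^{-4π²(k²+l²)t} cos (2π(kx+ly)+θ)` on the unit torus. -/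
@[ext] structure HeatMode where
  c : ℝ
  k : ℤ
  l : ℤ
  θ : ℝ

namespace HeatMode

/-- The Laplace eigenvalue of a mode. -/
def eig (a : HeatMode) : ℝ := 4 * π ^ 2 * ((a.k : ℝ) ^ 2 + (a.l : ℝ) ^ 2)

/-- The value of the mode at time `t` and position `P`. -/
def eval (a : HeatMode) (t : ℝ) (P : ℝ × ℝ) : ℝ :=
  a.c * exp (-a.eig * t) * cos (2 * π * (a.k * P.1 + a.l * P.2) + a.θ)

def dx (a : HeatMode) : HeatMode := ⟨a.c * (2 * π * a.k), a.k, a.l, a.θ + π / 2⟩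

def dy (a : HeatMode) : HeatMode := ⟨a.c * (2 * π * a.l), a.k, a.l, a.θ + π / 2⟩

def lap (a : HeatMode) : HeatMode := ⟨a.c * -a.eig, a.k, a.l, a.θ⟩

def invLap (a : HeatMode) : HeatMode := ⟨a.c * (-a.eig)⁻¹, a.k, a.l, a.θ⟩

def scale (r : ℝ) (a : HeatMode) : HeatMode := ⟨r * a.c, a.k, a.l, a.θ⟩

variable (a : HeatMode)

lemma eig_nonneg : 0 ≤ a.eig := by unfold eig; positivity

lemma one_le_eig (h : ¬(a.k = 0 ∧ a.l = 0)) : 1 ≤ a.eig := by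
  have h1 : (1 : ℝ) ≤ (a.k : ℝ) ^ 2 + (a.l : ℝ) ^ 2 := by
    have : 1 ≤ a.k ^ 2 + a.l ^ 2 := by
      by_contra! hlt
      have hk : a.k ^ 2 = 0 := by nlinarith [sq_nonneg a.k, sq_nonneg a.l]
      have hl : a.l ^ 2 = 0 := by nlinarith [sq_nonneg a.k, sq_nonneg a.l]
      exact h ⟨by simpa using hk, by simpa using hl⟩
    exact_mod_cast this
  have h2 : (1 : ℝ) ≤ 4 * π ^ 2 := by nlinarith [pi_gt_three]
  unfold eig
  nlinarith

lemma continuous_eval : Continuous fun p : ℝ × ℝ × ℝ => a.eval p.1 p.2 := by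
  unfold eval; fun_prop

lemma hasDerivAt_dx (t x y : ℝ) : HasDerivAt (fun s => a.eval t (s, y)) (a.dx.eval t (x, y)) x := by
  have h : HasDerivAt (fun s : ℝ => 2 * π * (a.k * s + a.l * y) + a.θ) (2 * π * a.k) x := by
    simpa using ((((hasDerivAt_id x).const_mul (a.k : ℝ)).add_const (a.l * y)).const_mul
      (2 * π)).add_const a.θ
  refine (h.cos.const_mul (a.c * exp (-a.eig * t))).congr_deriv ?_
  simp only [eval, dx, eig, ← add_assoc, cos_add_pi_div_two]
  ring

lemma hasDerivAt_dy (t x y : ℝ) : HasDerivAt (fun s => a.eval t (x, s)) (a.dy.eval t (x, y)) y := by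
  have h : HasDerivAt (fun s : ℝ => 2 * π * (a.k * x + a.l * s) + a.θ) (2 * π * a.l) y := by
    simpa using ((((hasDerivAt_id y).const_mul (a.l : ℝ)).const_add (a.k * x)).const_mul
      (2 * π)).add_const a.θ
  refine (h.cos.const_mul (a.c * exp (-a.eig * t))).congr_deriv ?_
  simp only [eval, dy, eig, ← add_assoc, cos_add_pi_div_two]
  ring

lemma hasDerivAt_dt (P : ℝ × ℝ) (t : ℝ) : HasDerivAt (fun s => a.eval s P) (a.lap.eval t P) t := by
  have h : HasDerivAt (fun s : ℝ => -a.eig * s) (-a.eig) t := by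
    simpa using (hasDerivAt_id t).const_mul (-a.eig)
  refine ((h.exp.const_mul a.c).mul_const
    (cos (2 * π * (a.k * P.1 + a.l * P.2) + a.θ))).congr_deriv ?_
  simp only [eval, lap, eig]
  ring_nf

lemma eval_periodic (t x y : ℝ) :
    a.eval t (x + 1, y) = a.eval t (x, y) ∧ a.eval t (x, y + 1) = a.eval t (x, y) := by
  constructor
  · simp only [eval]
    rw [← cos_add_int_mul_two_pi (2 * π * (a.k * x + a.l * y) + a.θ) a.k]
    ring_nf
  · simp only [eval]
    rw [← cos_add_int_mul_two_pi (2 * π * (a.k * x + a.l * y) + a.θ) a.l]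
    ring_nf

lemma eval_dx_dx_add_eval_dy_dy (t : ℝ) (P : ℝ × ℝ) :
    a.dx.dx.eval t P + a.dy.dy.eval t P = a.lap.eval t P := by
  simp only [eval, dx, dy, lap, eig, ← add_assoc, cos_add_pi_div_two, sin_add_pi_div_two]
  ring

lemma lap_dx : a.dx.lap = a.lap.dx := by
  ext <;> simp [dx, lap, eig]; ring

lemma lap_dy : a.dy.lap = a.lap.dy := by
  ext <;> simp [dy, lap, eig]; ring

lemma eval_scale (r t : ℝ) (P : ℝ × ℝ) : (a.scale r).eval t P = r * a.eval t P := by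
  simp only [eval, scale, eig]; ring

lemma exists_eval_invLap_lap : ∃ m : ℝ, ∀ t P, a.invLap.lap.eval t P = a.eval t P - m := by
  by_cases h : a.k = 0 ∧ a.l = 0
  · refine ⟨a.c * cos a.θ, fun t P => ?_⟩
    simp [eval, invLap, lap, eig, h.1, h.2]
  · have h1 : (-a.eig) ≠ 0 := by linarith [a.one_le_eig h]
    refine ⟨0, fun t P => ?_⟩
    have : a.invLap.lap = a := by
      ext <;> simp only [lap, invLap]
      change a.c * (-a.eig)⁻¹ * -a.eig = a.c
      rw [mul_assoc, inv_mul_cancel₀ h1, mul_one]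
    rw [this, sub_zero]

lemma abs_eval_le {t : ℝ} (ht : 0 ≤ t) (P : ℝ × ℝ) : |a.eval t P| ≤ |a.c| := by
  rw [eval, abs_mul, abs_mul, abs_exp]
  have h1 : exp (-a.eig * t) ≤ 1 := by
    rw [exp_le_one_iff]
    nlinarith [mul_nonneg a.eig_nonneg ht]
  have h2 := abs_cos_le_one (2 * π * (a.k * P.1 + a.l * P.2) + a.θ)
  have h3 : exp (-a.eig * t) * |cos (2 * π * (a.k * P.1 + a.l * P.2) + a.θ)| ≤ 1 * 1 :=
    mul_le_mul h1 h2 (abs_nonneg _) zero_le_one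
  nlinarith [abs_nonneg a.c]

lemma abs_eval_le_exp (h : a.k = 0 ∧ a.l = 0 → a.c = 0) {t : ℝ} (ht : 0 ≤ t) (P : ℝ × ℝ) :
    |a.eval t P| ≤ |a.c| * exp (-t) := by
  by_cases h0 : a.k = 0 ∧ a.l = 0
  · simp [eval, h h0]
  · rw [eval, abs_mul, abs_mul, abs_exp, mul_assoc]
    have h1 : exp (-a.eig * t) ≤ exp (-t) := by
      rw [exp_le_exp]
      nlinarith [a.one_le_eig h0]
    have h2 := abs_cos_le_one (2 * π * (a.k * P.1 + a.l * P.2) + a.θ)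
    have h3 := mul_le_mul h1 h2 (abs_nonneg _) (exp_nonneg _)
    rw [mul_one] at h3
    exact mul_le_mul_of_nonneg_left h3 (abs_nonneg _)

end HeatMode

/-- A real trigonometric polynomial on the unit torus, evolved by the heat flow up to time `t`. -/
def heat (L : List HeatMode) (t : ℝ) (P : ℝ × ℝ) : ℝ := (L.map fun a => a.eval t P).sum

open HeatMode

lemma heat_nil (t : ℝ) (P : ℝ × ℝ) : heat [] t P = 0 := rfl

lemma heat_cons (a : HeatMode) (L : List HeatMode) (t : ℝ) (P : ℝ × ℝ) :
    heat (a :: L) t P = a.eval t P + heat L t P := by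
  simp [heat]

lemma heat_append (L L' : List HeatMode) (t : ℝ) (P : ℝ × ℝ) :
    heat (L ++ L') t P = heat L t P + heat L' t P := by
  simp [heat]

lemma continuous_heat (L : List HeatMode) : Continuous fun p : ℝ × ℝ × ℝ => heat L p.1 p.2 := by
  induction L with
  | nil => exact continuous_const
  | cons a L ih =>
    simp only [heat_cons]
    exact a.continuous_eval.add ih

lemma hasDerivAt_heat_dx (L : List HeatMode) (t x y : ℝ) :
    HasDerivAt (fun s => heat L t (s, y)) (heat (L.map dx) t (x, y)) x := by
  induction L with
  | nil => exact hasDerivAt_const _ _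
  | cons a L ih =>
    simp only [heat_cons, List.map_cons]
    exact (a.hasDerivAt_dx t x y).add ih

lemma hasDerivAt_heat_dy (L : List HeatMode) (t x y : ℝ) :
    HasDerivAt (fun s => heat L t (x, s)) (heat (L.map dy) t (x, y)) y := by
  induction L with
  | nil => exact hasDerivAt_const _ _
  | cons a L ih =>
    simp only [heat_cons, List.map_cons]
    exact (a.hasDerivAt_dy t x y).add ih

lemma hasDerivAt_heat_dt (L : List HeatMode) (P : ℝ × ℝ) (t : ℝ) :
    HasDerivAt (fun s => heat L s P) (heat (L.map lap) t P) t := by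
  induction L with
  | nil => exact hasDerivAt_const _ _
  | cons a L ih =>
    simp only [heat_cons, List.map_cons]
    exact (a.hasDerivAt_dt P t).add ih

lemma heat_periodic (L : List HeatMode) (t x y : ℝ) :
    heat L t (x + 1, y) = heat L t (x, y) ∧ heat L t (x, y + 1) = heat L t (x, y) := by
  simp only [heat, (eval_periodic _ t x y).1, (eval_periodic _ t x y).2, and_self]

lemma continuous_heat_time (L : List HeatMode) (t : ℝ) : Continuous (heat L t) :=
  (continuous_heat L).comp (by fun_prop : Continuous fun P : ℝ × ℝ => (t, P))

lemma perC1_heat (L : List HeatMode) (t : ℝ) :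
    PerC1 (heat L t) (heat (L.map dx) t) (heat (L.map dy) t) where
  cont := continuous_heat_time L t
  contx := continuous_heat_time _ t
  conty := continuous_heat_time _ t
  dx := hasDerivAt_heat_dx L t
  dy := hasDerivAt_heat_dy L t
  per := heat_periodic L t

lemma heat_dx_dx_add_heat_dy_dy (L : List HeatMode) (t : ℝ) (P : ℝ × ℝ) :
    heat ((L.map dx).map dx) t P + heat ((L.map dy).map dy) t P = heat (L.map lap) t P := by
  induction L with
  | nil => simp [heat_nil]
  | cons a L ih =>
    simp only [heat_cons, List.map_cons]
    rw [← ih, ← a.eval_dx_dx_add_eval_dy_dy]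
    ring

lemma map_dx_map_lap (L : List HeatMode) : (L.map dx).map lap = (L.map lap).map dx := by
  simp [lap_dx]

lemma map_dy_map_lap (L : List HeatMode) : (L.map dy).map lap = (L.map lap).map dy := by
  simp [lap_dy]

lemma heat_scale (r : ℝ) (L : List HeatMode) (t : ℝ) (P : ℝ × ℝ) :
    heat (L.map (scale r)) t P = r * heat L t P := by
  induction L with
  | nil => simp [heat_nil]
  | cons a L ih => simp only [heat_cons, List.map_cons, ih, eval_scale]; ring

lemma integral_heat_lap (L : List HeatMode) (t : ℝ) : ∫ P in sqM, heat (L.map lap) t P = 0 := by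
  simp only [← heat_dx_dx_add_heat_dy_dy]
  exact (perC1_heat (L.map dx) t).integral_div (perC1_heat (L.map dy) t)

/-- `invLap` inverts the Laplacian modulo the mean value. -/
lemma heat_invLap_lap (L : List HeatMode) (P : ℝ × ℝ) :
    heat ((L.map invLap).map lap) 0 P = heat L 0 P - ∫ Q in sqM, heat L 0 Q := by
  have key : ∃ m : ℝ, ∀ Q, heat ((L.map invLap).map lap) 0 Q = heat L 0 Q - m := by
    induction L with
    | nil => exact ⟨0, by simp [heat_nil]⟩
    | cons a L ih =>
      obtain ⟨m, hm⟩ := ih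
      obtain ⟨m', hm'⟩ := a.exists_eval_invLap_lap
      refine ⟨m' + m, fun Q => ?_⟩
      simp only [heat_cons, List.map_cons]
      rw [hm, hm']
      ring
  obtain ⟨m, hm⟩ := key
  have h := integral_heat_lap (L.map invLap) 0
  simp only [hm] at h
  rw [integral_sub (continuous_heat_time L 0).integrableOn_sqM (integrable_const m), MeasureTheory.integral_const,
    probReal_univ, one_smul] at h
  rw [hm]
  linarith

lemma exists_abs_heat_le (L : List HeatMode) : ∃ K, ∀ t, 0 ≤ t → ∀ P, |heat L t P| ≤ K := by
  induction L with
  | nil => exact ⟨0, by simp [heat_nil]⟩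
  | cons a L ih =>
    obtain ⟨K, hK⟩ := ih
    refine ⟨|a.c| + K, fun t ht P => ?_⟩
    rw [heat_cons]
    exact (abs_add_le _ _).trans (add_le_add (a.abs_eval_le ht P) (hK t ht P))

lemma exists_abs_heat_le_exp (L : List HeatMode) (hL : ∀ a ∈ L, a.k = 0 ∧ a.l = 0 → a.c = 0) :
    ∃ K, ∀ t, 0 ≤ t → ∀ P, |heat L t P| ≤ K * exp (-t) := by
  induction L with
  | nil => exact ⟨0, by simp [heat_nil]⟩
  | cons a L ih =>
    obtain ⟨K, hK⟩ := ih fun b hb => hL b (List.mem_cons_of_mem _ hb)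
    refine ⟨|a.c| + K, fun t ht P => ?_⟩
    rw [heat_cons, add_mul]
    exact (abs_add_le _ _).trans
      (add_le_add (a.abs_eval_le_exp (hL a List.mem_cons_self) ht P) (hK t ht P))

/-- A Bellman function for the heat flow: a `C²` function `B u v`, dominated by
`1 + |u|^r + |v|^r'`, whose Hessian dominates `τ a² + τ⁻¹ b²` for some `τ > 0` depending on the
point. -/
structure IsBellman (r r' : ℝ) (B Bu Bv Buu Buv Bvv : ℝ → ℝ → ℝ) : Prop where
  cont : Continuous fun p : ℝ × ℝ => B p.1 p.2
  cont_u : Continuous fun p : ℝ × ℝ => Bu p.1 p.2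
  cont_v : Continuous fun p : ℝ × ℝ => Bv p.1 p.2
  cont_uu : Continuous fun p : ℝ × ℝ => Buu p.1 p.2
  cont_uv : Continuous fun p : ℝ × ℝ => Buv p.1 p.2
  cont_vv : Continuous fun p : ℝ × ℝ => Bvv p.1 p.2
  deriv : ∀ {u v : ℝ → ℝ} {a b s : ℝ}, HasDerivAt u a s → HasDerivAt v b s →
    HasDerivAt (fun x => B (u x) (v x)) (Bu (u s) (v s) * a + Bv (u s) (v s) * b) s
  deriv_u : ∀ {u v : ℝ → ℝ} {a b s : ℝ}, HasDerivAt u a s → HasDerivAt v b s →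
    HasDerivAt (fun x => Bu (u x) (v x)) (Buu (u s) (v s) * a + Buv (u s) (v s) * b) s
  deriv_v : ∀ {u v : ℝ → ℝ} {a b s : ℝ}, HasDerivAt u a s → HasDerivAt v b s →
    HasDerivAt (fun x => Bv (u x) (v x)) (Buv (u s) (v s) * a + Bvv (u s) (v s) * b) s
  nonneg : ∀ u v, 0 ≤ B u v
  bound : ∃ C, 0 ≤ C ∧ ∀ u v, B u v ≤ C * (1 + |u| ^ r + |v| ^ r')
  hess : ∀ u v, ∃ τ, 0 < τ ∧ ∀ a b, 1 / 6 * (τ * a ^ 2 + τ⁻¹ * b ^ 2) ≤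
    Buu u v * a ^ 2 + 2 * Buv u v * a * b + Bvv u v * b ^ 2

lemma IsBellman.swap {r r' : ℝ} {B Bu Bv Buu Buv Bvv : ℝ → ℝ → ℝ}
    (h : IsBellman r r' B Bu Bv Buu Buv Bvv) :
    IsBellman r' r (fun u v => B v u) (fun u v => Bv v u) (fun u v => Bu v u)
      (fun u v => Bvv v u) (fun u v => Buv v u) (fun u v => Buu v u) where
  cont := h.cont.comp continuous_swap
  cont_u := h.cont_v.comp continuous_swap
  cont_v := h.cont_u.comp continuous_swap
  cont_uu := h.cont_vv.comp continuous_swap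
  cont_uv := h.cont_uv.comp continuous_swap
  cont_vv := h.cont_uu.comp continuous_swap
  deriv hu hv := (h.deriv hv hu).congr_deriv (add_comm _ _)
  deriv_u hu hv := (h.deriv_v hv hu).congr_deriv (add_comm _ _)
  deriv_v hu hv := (h.deriv_u hv hu).congr_deriv (add_comm _ _)
  nonneg u v := h.nonneg v u
  bound := by
    obtain ⟨C, hC, hB⟩ := h.bound
    exact ⟨C, hC, fun u v => (hB v u).trans_eq (by ring)⟩
  hess u v := by
    obtain ⟨τ, hτ, hB⟩ := h.hess v u
    refine ⟨τ⁻¹, inv_pos.2 hτ, fun a b => ?_⟩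
    rw [inv_inv]
    linarith [hB b a]

namespace Bellman

variable (p q : ℝ)

/-- `√(1 + v²)`. -/
def N (v : ℝ) : ℝ := √(1 + v ^ 2)

/-- `N ^ (2(q-1))`. -/
def W (v : ℝ) : ℝ := (1 + v ^ 2) ^ (q - 1)

def S (u v : ℝ) : ℝ := √(W q v + u ^ 2)

/-- The constant in front of the convex power of `v`. -/
def A : ℝ := 7 / (q * (q - 1))

def B (u v : ℝ) : ℝ := (1 + u ^ 2) ^ (p / 2) + A q * (1 + v ^ 2) ^ (q / 2) + N v * S q u v

def Bu (u v : ℝ) : ℝ := p * u * (1 + u ^ 2) ^ (p / 2 - 1) + N v * u / S q u v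

def Bv (u v : ℝ) : ℝ :=
  v * (A q * q * (1 + v ^ 2) ^ (q / 2 - 1) + S q u v / N v + (q - 1) * W q v / (N v * S q u v))

def Buu (u v : ℝ) : ℝ :=
  p * (1 + u ^ 2) ^ (p / 2 - 1) + p * (p - 2) * u ^ 2 * (1 + u ^ 2) ^ (p / 2 - 2) +
    N v * W q v / S q u v ^ 3

def Buv (u v : ℝ) : ℝ := u * v / (N v * S q u v) * (1 - (q - 1) * W q v / S q u v ^ 2)

def Bvv (u v : ℝ) : ℝ :=
  A q * q * (1 + v ^ 2) ^ (q / 2 - 1) + A q * q * (q - 2) * v ^ 2 * (1 + v ^ 2) ^ (q / 2 - 2) +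
    (S q u v / N v + (q - 1) * W q v / (N v * S q u v) +
      v ^ 2 / N v ^ 3 * (-S q u v + 2 * (q - 1) ^ 2 * W q v / S q u v -
        (q - 1) ^ 2 * W q v ^ 2 / S q u v ^ 3))

lemma one_add_sq_pos (v : ℝ) : 0 < 1 + v ^ 2 := by positivity

lemma N_pos (v : ℝ) : 0 < N v := sqrt_pos.2 (one_add_sq_pos v)

lemma N_sq (v : ℝ) : N v ^ 2 = 1 + v ^ 2 := sq_sqrt (one_add_sq_pos v).le

lemma W_pos (v : ℝ) : 0 < W q v := rpow_pos_of_pos (one_add_sq_pos v) _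

lemma W_add_pos (u v : ℝ) : 0 < W q v + u ^ 2 := add_pos_of_pos_of_nonneg (W_pos q v) (sq_nonneg u)

lemma S_pos (u v : ℝ) : 0 < S q u v := sqrt_pos.2 (W_add_pos q u v)

lemma S_sq (u v : ℝ) : S q u v ^ 2 = W q v + u ^ 2 := sq_sqrt (W_add_pos q u v).le

section Derivatives

variable {u v : ℝ → ℝ} {a b s : ℝ}

lemma hasDerivAt_one_add_sq (hv : HasDerivAt v b s) :
    HasDerivAt (fun x => 1 + v x ^ 2) (2 * v s * b) s := by
  simpa using (hv.pow 2).const_add 1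

lemma hasDerivAt_rpow_one_add_sq (hv : HasDerivAt v b s) (m : ℝ) :
    HasDerivAt (fun x => (1 + v x ^ 2) ^ m) (2 * m * v s * b * (1 + v s ^ 2) ^ (m - 1)) s :=
  ((hasDerivAt_one_add_sq hv).rpow_const (p := m) (Or.inl (one_add_sq_pos _).ne')).congr_deriv
    (by ring)

lemma hasDerivAt_N (hv : HasDerivAt v b s) :
    HasDerivAt (fun x => N (v x)) (v s * b / N (v s)) s :=
  ((hasDerivAt_one_add_sq hv).sqrt (one_add_sq_pos _).ne').congr_deriv
    (by rw [N]; field_simp)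

lemma hasDerivAt_W (hv : HasDerivAt v b s) :
    HasDerivAt (fun x => W q (v x)) (2 * (q - 1) * v s * b * W q (v s) / N (v s) ^ 2) s :=
  (hasDerivAt_rpow_one_add_sq hv (q - 1)).congr_deriv (by
    rw [rpow_sub_one (one_add_sq_pos _).ne', N_sq, W]; ring)

lemma hasDerivAt_S (hu : HasDerivAt u a s) (hv : HasDerivAt v b s) :
    HasDerivAt (fun x => S q (u x) (v x))
      (((q - 1) * v s * b * W q (v s) / N (v s) ^ 2 + u s * a) / S q (u s) (v s)) s :=
  (((hasDerivAt_W q hv).add (hu.pow 2)).sqrt (W_add_pos q _ _).ne').congr_deriv (by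
    have := (N_pos (v s)).ne'
    simp only [S, Pi.add_apply, Pi.pow_apply]
    field_simp
    push_cast
    ring)

lemma hasDerivAt_B (hu : HasDerivAt u a s) (hv : HasDerivAt v b s) :
    HasDerivAt (fun x => B p q (u x) (v x))
      (Bu p q (u s) (v s) * a + Bv q (u s) (v s) * b) s :=
  (((hasDerivAt_rpow_one_add_sq hu (p / 2)).add
    ((hasDerivAt_rpow_one_add_sq hv (q / 2)).const_mul (A q))).add
    ((hasDerivAt_N hv).mul (hasDerivAt_S q hu hv))).congr_deriv (by
      have hN := (N_pos (v s)).ne'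
      have hS := (S_pos q (u s) (v s)).ne'
      simp only [Bu, Bv]
      field_simp
      ring)

lemma hasDerivAt_Bu (hu : HasDerivAt u a s) (hv : HasDerivAt v b s) :
    HasDerivAt (fun x => Bu p q (u x) (v x))
      (Buu p q (u s) (v s) * a + Buv q (u s) (v s) * b) s :=
  (((hu.const_mul p).mul (hasDerivAt_rpow_one_add_sq hu (p / 2 - 1))).add
    (((hasDerivAt_N hv).mul hu).div (hasDerivAt_S q hu hv)
      (S_pos q (u s) (v s)).ne')).congr_deriv (by
      have hN := (N_pos (v s)).ne'
      have hS := (S_pos q (u s) (v s)).ne'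
      have hW : W q (v s) = S q (u s) (v s) ^ 2 - u s ^ 2 := by rw [S_sq]; ring
      simp only [Buu, Buv, hW, Pi.mul_apply]
      rw [show p / 2 - 1 - 1 = p / 2 - 2 by ring]
      field_simp
      ring)

lemma hasDerivAt_Bv (hu : HasDerivAt u a s) (hv : HasDerivAt v b s) :
    HasDerivAt (fun x => Bv q (u x) (v x))
      (Buv q (u s) (v s) * a + Bvv q (u s) (v s) * b) s :=
  (hv.mul ((((hasDerivAt_rpow_one_add_sq hv (q / 2 - 1)).const_mul (A q * q)).add
    ((hasDerivAt_S q hu hv).div (hasDerivAt_N hv) (N_pos (v s)).ne')).add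
    (((hasDerivAt_W q hv).const_mul (q - 1)).div ((hasDerivAt_N hv).mul (hasDerivAt_S q hu hv))
      (mul_pos (N_pos (v s)) (S_pos q (u s) (v s))).ne'))).congr_deriv (by
      have hN := (N_pos (v s)).ne'
      have hS := (S_pos q (u s) (v s)).ne'
      simp only [Buv, Bvv, Pi.mul_apply, Pi.add_apply, Pi.div_apply]
      rw [show q / 2 - 1 - 1 = q / 2 - 2 by ring]
      field_simp
      ring)

end Derivatives

variable {p q}

lemma one_lt_of_holderConjugate (h : p.HolderConjugate q) : 1 < q := h.symm.lt

lemma sub_one_mul_sub_one (h : p.HolderConjugate q) : (q - 1) * (p - 1) = 1 := by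
  linarith [h.mul_eq_add]

lemma abs_Buv_le_one (hq : 1 < q) (hq2 : q ≤ 2) (u v : ℝ) : |Buv q u v| ≤ 1 := by
  have hN := N_pos v
  have hS := S_pos q u v
  have hW := W_pos q v
  have hu : |u| / S q u v ≤ 1 := by
    rw [div_le_one hS]
    exact abs_le_of_sq_le_sq' (by nlinarith [S_sq q u v]) hS.le |> abs_le.2
  have hv : |v| / N v ≤ 1 := by
    rw [div_le_one hN]
    exact abs_le_of_sq_le_sq' (by nlinarith [N_sq v]) hN.le |> abs_le.2
  have hK : |1 - (q - 1) * W q v / S q u v ^ 2| ≤ 1 := by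
    have h1 : W q v / S q u v ^ 2 ≤ 1 := by
      rw [div_le_one (by positivity), S_sq]; nlinarith
    have h2 : 0 ≤ W q v / S q u v ^ 2 := by positivity
    rw [mul_div_assoc, abs_le]
    constructor <;> nlinarith
  have h1 : |u * v / (N v * S q u v)| ≤ 1 := by
    rw [abs_div, abs_mul, abs_mul, abs_of_pos hN, abs_of_pos hS, mul_comm (N v), mul_div_mul_comm]
    exact mul_le_one₀ hu (by positivity) hv
  rw [Buv, abs_mul]
  exact mul_le_one₀ h1 (abs_nonneg _) hK

lemma rpow_le_Bvv (hq : 1 < q) (hq2 : q ≤ 2) (u v : ℝ) : 7 * (1 + v ^ 2) ^ (q / 2 - 1) ≤ Bvv q u v := by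
  have hN := N_pos v
  have hS := S_pos q u v
  have hW := W_pos q v
  have hE := one_add_sq_pos v
  have hA : A q * q * (q - 1) = 7 := by
    have : q - 1 ≠ 0 := by linarith
    have : q ≠ 0 := by linarith
    rw [A]; field_simp
  have hA0 : 0 ≤ A q * q := by
    have h1 : 0 < q - 1 := by linarith
    by_contra! h
    nlinarith
  have hr : (1 + v ^ 2) ^ (q / 2 - 1) = (1 + v ^ 2) ^ (q / 2 - 2) * (1 + v ^ 2) := by
    rw [← rpow_add_one hE.ne']; ring_nf
  have h1 : 7 * (1 + v ^ 2) ^ (q / 2 - 1) ≤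
      A q * q * (1 + v ^ 2) ^ (q / 2 - 1) +
        A q * q * (q - 2) * v ^ 2 * (1 + v ^ 2) ^ (q / 2 - 2) := by
    rw [hr, ← hA]
    have : 0 ≤ A q * q * (1 + v ^ 2) ^ (q / 2 - 2) * 1 :=
      mul_nonneg (mul_nonneg hA0 (by positivity)) zero_le_one
    nlinarith [mul_nonneg this (by linarith : 0 ≤ 2 - q)]
  have h2 : 0 ≤ S q u v / N v + (q - 1) * W q v / (N v * S q u v) +
      v ^ 2 / N v ^ 3 * (-S q u v + 2 * (q - 1) ^ 2 * W q v / S q u v -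
        (q - 1) ^ 2 * W q v ^ 2 / S q u v ^ 3) := by
    have e : S q u v / N v + (q - 1) * W q v / (N v * S q u v) +
      v ^ 2 / N v ^ 3 * (-S q u v + 2 * (q - 1) ^ 2 * W q v / S q u v -
        (q - 1) ^ 2 * W q v ^ 2 / S q u v ^ 3) =
        S q u v / N v ^ 3 * (N v ^ 2 - v ^ 2) + (q - 1) * W q v / (N v * S q u v) +
        v ^ 2 / N v ^ 3 * ((q - 1) ^ 2 * W q v / S q u v ^ 3 * (2 * S q u v ^ 2 - W q v)) := by
      field_simp
      ring
    rw [e, N_sq, S_sq]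
    have h3 : 0 ≤ q - 1 := by linarith
    have h4 : 0 ≤ 2 * (W q v + u ^ 2) - W q v := by nlinarith
    have h5 : 0 ≤ 1 + v ^ 2 - v ^ 2 := by linarith
    positivity
  rw [Bvv]
  linarith

lemma rpow_le_Buu (h : p.HolderConjugate q) (hp : 2 ≤ p) (u v : ℝ) :
    1 / 3 * (1 + v ^ 2) ^ (1 - q / 2) ≤ Buu p q u v := by
  have hN := N_pos v
  have hS := S_pos q u v
  have hW := W_pos q v
  have hE := one_add_sq_pos v
  have hEu := one_add_sq_pos u
  have hp2 : 0 ≤ p - 2 := by linarith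
  have h0 : 0 ≤ p * (p - 2) * u ^ 2 * (1 + u ^ 2) ^ (p / 2 - 2) := by positivity
  have h0' : 0 ≤ p * (1 + u ^ 2) ^ (p / 2 - 1) := by positivity
  have hτ : 0 < (1 + v ^ 2) ^ (1 - q / 2) := by positivity
  rw [Buu]
  rcases le_total (u ^ 2) (W q v) with hu | hu
  · have hw : 0 < (1 + v ^ 2) ^ ((q - 1) / 2) := by positivity
    have hw2 : ((1 + v ^ 2) ^ ((q - 1) / 2)) ^ 2 = W q v := by
      rw [← rpow_mul_natCast hE.le, W]; push_cast; ring_nf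
    have hNw : N v = (1 + v ^ 2) ^ (1 - q / 2) * (1 + v ^ 2) ^ ((q - 1) / 2) := by
      rw [← rpow_add hE, N, sqrt_eq_rpow]; ring_nf
    set τ := (1 + v ^ 2) ^ (1 - q / 2)
    set w := (1 + v ^ 2) ^ ((q - 1) / 2)
    have hS2 : S q u v ^ 2 ≤ 2 * w ^ 2 := by rw [S_sq, hw2]; linarith
    have hSw : S q u v ≤ 3 / 2 * w := by
      refine abs_le_of_sq_le_sq' ?_ (by positivity) |>.2
      nlinarith
    have hS3 : S q u v ^ 3 ≤ 3 * w ^ 3 := by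
      calc S q u v ^ 3 = S q u v * S q u v ^ 2 := by ring
        _ ≤ (3 / 2 * w) * (2 * w ^ 2) := by gcongr
        _ = 3 * w ^ 3 := by ring
    have : 1 / 3 * τ ≤ N v * W q v / S q u v ^ 3 := by
      rw [le_div_iff₀ (by positivity), hNw, ← hw2]
      calc 1 / 3 * τ * S q u v ^ 3 ≤ 1 / 3 * τ * (3 * w ^ 3) := by gcongr
        _ = τ * w * w ^ 2 := by ring
    linarith
  · have h1 : (1 + v ^ 2) ^ (1 - q / 2) ≤ (1 + u ^ 2) ^ (p / 2 - 1) := by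
      have e : (1 + v ^ 2) ^ (1 - q / 2) = W q v ^ (p / 2 - 1) := by
        rw [W, ← rpow_mul hE.le]
        congr 1
        linarith [sub_one_mul_sub_one h]
      rw [e]
      exact rpow_le_rpow hW.le (by linarith) (by linarith)
    have h2 : 0 ≤ N v * W q v / S q u v ^ 3 := by positivity
    nlinarith

lemma hess_le (h : p.HolderConjugate q) (hp : 2 ≤ p) (u v : ℝ) : ∃ τ : ℝ, 0 < τ ∧ ∀ a b : ℝ,
    1 / 6 * (τ * a ^ 2 + τ⁻¹ * b ^ 2) ≤
      Buu p q u v * a ^ 2 + 2 * Buv q u v * a * b + Bvv q u v * b ^ 2 := by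
  have hE := one_add_sq_pos v
  have hq := one_lt_of_holderConjugate h
  have hq2 : q ≤ 2 := by nlinarith [sub_one_mul_sub_one h]
  refine ⟨(1 + v ^ 2) ^ (1 - q / 2), by positivity, fun a b => ?_⟩
  have h1 := rpow_le_Buu h hp u v
  have h2 := rpow_le_Bvv hq hq2 u v
  have h3 := abs_Buv_le_one hq hq2 u v
  have hinv : (1 + v ^ 2) ^ (q / 2 - 1) = ((1 + v ^ 2) ^ (1 - q / 2))⁻¹ := by
    rw [← rpow_neg hE.le]; ring_nf
  rw [hinv] at h2
  have hτ : 0 < (1 + v ^ 2) ^ (1 - q / 2) := by positivity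
  set τ := (1 + v ^ 2) ^ (1 - q / 2)
  have h4 : -|a * b| ≤ Buv q u v * (a * b) := by
    have := neg_abs_le (Buv q u v * (a * b))
    rw [abs_mul] at this
    nlinarith [abs_nonneg (a * b)]
  have h5 : 2 * |a * b| ≤ 1 / 6 * (τ * a ^ 2) + 6 * (τ⁻¹ * b ^ 2) := by
    have e : τ * τ⁻¹ = 1 := mul_inv_cancel₀ hτ.ne'
    have hi : 0 < τ⁻¹ := inv_pos.2 hτ
    have h6 : 0 ≤ τ⁻¹ * (τ * |a| - 6 * |b|) ^ 2 := by positivity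
    have h7 : τ⁻¹ * (τ * |a| - 6 * |b|) ^ 2 =
        (τ * τ⁻¹) * τ * |a| ^ 2 - 12 * (τ * τ⁻¹) * (|a| * |b|) + 36 * (τ⁻¹ * |b| ^ 2) := by ring
    rw [h7, e, sq_abs, sq_abs] at h6
    rw [abs_mul]
    linarith
  have h8 : 0 ≤ τ⁻¹ := (inv_pos.2 hτ).le
  nlinarith [mul_le_mul_of_nonneg_right h1 (sq_nonneg a), mul_le_mul_of_nonneg_right h2 (sq_nonneg b),
    mul_nonneg h8 (sq_nonneg b)]

lemma rpow_one_add_sq_le {m : ℝ} (hm : 0 ≤ m) (x : ℝ) :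
    (1 + x ^ 2) ^ (m / 2) ≤ 2 ^ (m / 2) * (1 + |x| ^ m) := by
  have e : |x| ^ m = (x ^ 2) ^ (m / 2) := by
    rw [← sq_abs, ← rpow_natCast_mul (abs_nonneg x)]; push_cast; ring_nf
  rcases le_total (x ^ 2) 1 with h | h
  · calc (1 + x ^ 2) ^ (m / 2) ≤ 2 ^ (m / 2) :=
          rpow_le_rpow (by positivity) (by linarith) (by positivity)
      _ ≤ 2 ^ (m / 2) * (1 + |x| ^ m) := le_mul_of_one_le_right (by positivity)
          (by linarith [rpow_nonneg (abs_nonneg x) m])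
  · calc (1 + x ^ 2) ^ (m / 2) ≤ (2 * x ^ 2) ^ (m / 2) :=
          rpow_le_rpow (by positivity) (by linarith) (by positivity)
      _ = 2 ^ (m / 2) * |x| ^ m := by rw [mul_rpow (by norm_num) (sq_nonneg x), e]
      _ ≤ 2 ^ (m / 2) * (1 + |x| ^ m) := by gcongr; linarith

lemma A_pos (hq : 1 < q) : 0 < A q := by
  have : 0 < q - 1 := by linarith
  rw [A]; positivity

lemma N_mul_S_le (h : p.HolderConjugate q) (u v : ℝ) :
    N v * S q u v ≤ 2 * (1 + v ^ 2) ^ (q / 2) + |u| ^ p := by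
  have hN := N_pos v
  have hE := one_add_sq_pos v
  have hq := one_lt_of_holderConjugate h
  have hw : 0 < (1 + v ^ 2) ^ ((q - 1) / 2) := by positivity
  have hw2 : ((1 + v ^ 2) ^ ((q - 1) / 2)) ^ 2 = W q v := by
    rw [← rpow_mul_natCast hE.le, W]; push_cast; ring_nf
  have hNw : N v * (1 + v ^ 2) ^ ((q - 1) / 2) = (1 + v ^ 2) ^ (q / 2) := by
    rw [N, sqrt_eq_rpow, ← rpow_add hE]; ring_nf
  have hNq : N v ^ q = (1 + v ^ 2) ^ (q / 2) := by
    rw [N, sqrt_eq_rpow, ← rpow_mul hE.le]; ring_nf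
  have hS : S q u v ≤ (1 + v ^ 2) ^ ((q - 1) / 2) + |u| := by
    rw [S, ← hw2, ← sq_abs u]
    exact sqrt_le_iff.2 ⟨by positivity, by nlinarith [abs_nonneg u]⟩
  have hy := young_inequality_of_nonneg hN.le (abs_nonneg u) h.symm
  have h1 : N v ^ q / q ≤ N v ^ q := div_le_self (by positivity) hq.le
  have h2 : |u| ^ p / p ≤ |u| ^ p := div_le_self (by positivity) h.lt.le
  calc N v * S q u v ≤ N v * ((1 + v ^ 2) ^ ((q - 1) / 2) + |u|) := by gcongr
    _ = (1 + v ^ 2) ^ (q / 2) + N v * |u| := by rw [mul_add, hNw]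
    _ ≤ 2 * (1 + v ^ 2) ^ (q / 2) + |u| ^ p := by linarith

lemma continuous_N : Continuous N := by unfold N; fun_prop

lemma continuous_rpow_one_add_sq (m : ℝ) : Continuous fun v : ℝ => (1 + v ^ 2) ^ m :=
  Continuous.rpow_const (by fun_prop) fun v => Or.inl (one_add_sq_pos v).ne'

lemma continuous_W : Continuous (W q) := continuous_rpow_one_add_sq _

lemma continuous_S : Continuous fun x : ℝ × ℝ => S q x.1 x.2 := by
  have := continuous_W (q := q)
  unfold S; fun_prop

theorem isBellman (h : p.HolderConjugate q) (hp : 2 ≤ p) :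
    IsBellman p q (B p q) (Bu p q) (Bv q) (Buu p q) (Buv q) (Bvv q) := by
  have cN : Continuous fun x : ℝ × ℝ => N x.2 := continuous_N.comp continuous_snd
  have cW : Continuous fun x : ℝ × ℝ => W q x.2 := continuous_W.comp continuous_snd
  have cS := continuous_S (q := q)
  have cu : ∀ m : ℝ, Continuous fun x : ℝ × ℝ => (1 + x.1 ^ 2) ^ m := fun m =>
    (continuous_rpow_one_add_sq m).comp continuous_fst
  have cv : ∀ m : ℝ, Continuous fun x : ℝ × ℝ => (1 + x.2 ^ 2) ^ m := fun m =>
    (continuous_rpow_one_add_sq m).comp continuous_snd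
  have hN : ∀ x : ℝ × ℝ, N x.2 ≠ 0 := fun x => (N_pos x.2).ne'
  have hS : ∀ x : ℝ × ℝ, S q x.1 x.2 ≠ 0 := fun x => (S_pos q x.1 x.2).ne'
  have hN3 : ∀ x : ℝ × ℝ, N x.2 ^ 3 ≠ 0 := fun x => pow_ne_zero _ (hN x)
  have hS2 : ∀ x : ℝ × ℝ, S q x.1 x.2 ^ 2 ≠ 0 := fun x => pow_ne_zero _ (hS x)
  have hS3 : ∀ x : ℝ × ℝ, S q x.1 x.2 ^ 3 ≠ 0 := fun x => pow_ne_zero _ (hS x)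
  have hNS : ∀ x : ℝ × ℝ, N x.2 * S q x.1 x.2 ≠ 0 := fun x => mul_ne_zero (hN x) (hS x)
  have hq := one_lt_of_holderConjugate h
  have hA := A_pos hq
  refine ⟨?_, ?_, ?_, ?_, ?_, ?_, hasDerivAt_B p q, hasDerivAt_Bu p q, hasDerivAt_Bv q, ?_, ?_,
    hess_le h hp⟩
  · unfold B; fun_prop
  · unfold Bu; fun_prop (disch := assumption)
  · unfold Bv; fun_prop (disch := assumption)
  · unfold Buu; fun_prop (disch := assumption)
  · unfold Buv; fun_prop (disch := assumption)
  · unfold Bvv; fun_prop (disch := assumption)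
  · intro u v
    have := N_pos v
    have := S_pos q u v
    unfold B
    positivity
  · refine ⟨2 ^ (p / 2) + 1 + (A q + 2) * 2 ^ (q / 2), by positivity, fun u v => ?_⟩
    have h1 := rpow_one_add_sq_le (by linarith : 0 ≤ p) u
    have h2 := rpow_one_add_sq_le (by linarith : 0 ≤ q) v
    have h3 := N_mul_S_le h u v
    have hu : 0 ≤ |u| ^ p := by positivity
    have hv : 0 ≤ |v| ^ q := by positivity
    have h4 : 0 < (2 : ℝ) ^ (p / 2) := by positivity
    have h5 : 0 < (2 : ℝ) ^ (q / 2) := by positivity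
    unfold B
    calc _ ≤ 2 ^ (p / 2) * (1 + |u| ^ p) + A q * (2 ^ (q / 2) * (1 + |v| ^ q)) +
          (2 * (2 ^ (q / 2) * (1 + |v| ^ q)) + |u| ^ p) := by
            gcongr
            linarith
      _ = (2 ^ (p / 2) * (1 + |u| ^ p) + |u| ^ p) +
          (A q + 2) * 2 ^ (q / 2) * (1 + |v| ^ q) := by ring
      _ ≤ _ := by
          have : 0 ≤ (A q + 2) * 2 ^ (q / 2) * |u| ^ p := by positivity
          nlinarith [mul_nonneg h4.le hv]

end Bellman

/-- The two coordinate derivatives of heat modes. -/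
def IsDir (D : HeatMode → HeatMode) : Prop := D = dx ∨ D = dy

lemma integral_heat_dir_mul {D : HeatMode → HeatMode} (hD : IsDir D) (L M : List HeatMode) (t : ℝ) :
    ∫ P in sqM, heat (L.map D) t P * heat M t P = -∫ P in sqM, heat L t P * heat (M.map D) t P := by
  have h := (perC1_heat L t).mul (perC1_heat M t)
  have hc : ∀ L M : List HeatMode, IntegrableOn (fun P => heat L t P * heat M t P) sqM := fun L M =>
    ((continuous_heat_time L t).mul (continuous_heat_time M t)).integrableOn_sqM
  rw [eq_neg_iff_add_eq_zero, ← integral_add (hc _ _) (hc _ _)]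
  rcases hD with rfl | rfl
  exacts [h.integral_dx, h.integral_dy]

lemma integral_heat_mul_lap (L M : List HeatMode) (t : ℝ) :
    ∫ P in sqM, heat L t P * heat (M.map lap) t P =
      ∫ P in sqM, heat (L.map lap) t P * heat M t P := by
  have hc : ∀ L M : List HeatMode, IntegrableOn (fun P => heat L t P * heat M t P) sqM := fun L M =>
    ((continuous_heat_time L t).mul (continuous_heat_time M t)).integrableOn_sqM
  have key : ∀ D, IsDir D → ∫ P in sqM, heat L t P * heat ((M.map D).map D) t P =
      ∫ P in sqM, heat ((L.map D).map D) t P * heat M t P := fun D hD => by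
    have h1 := integral_heat_dir_mul hD L (M.map D) t
    have h2 := integral_heat_dir_mul hD (L.map D) M t
    linarith
  simp only [← heat_dx_dx_add_heat_dy_dy, mul_add, add_mul]
  rw [integral_add (hc _ _) (hc _ _), integral_add (hc _ _) (hc _ _), key dx (Or.inl rfl),
    key dy (Or.inr rfl)]

lemma exists_abs_heat_dir_le_exp {D : HeatMode → HeatMode} (hD : IsDir D) (L : List HeatMode) :
    ∃ K, ∀ t, 0 ≤ t → ∀ P, |heat (L.map D) t P| ≤ K * exp (-t) := by
  refine exists_abs_heat_le_exp _ fun a ha => ?_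
  obtain ⟨b, -, rfl⟩ := List.mem_map.1 ha
  rcases hD with rfl | rfl <;> rintro ⟨h1, h2⟩ <;> simp_all [dx, dy]

section Flow

variable {r r' : ℝ} {B Bu Bv Buu Buv Bvv : ℝ → ℝ → ℝ}

lemma IsBellman.perC1_u (hB : IsBellman r r' B Bu Bv Buu Buv Bvv)
    {u ux uy v vx vy : ℝ × ℝ → ℝ} (hu : PerC1 u ux uy) (hv : PerC1 v vx vy) :
    PerC1 (fun P => Bu (u P) (v P)) (fun P => Buu (u P) (v P) * ux P + Buv (u P) (v P) * vx P)
      (fun P => Buu (u P) (v P) * uy P + Buv (u P) (v P) * vy P) := by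
  have hc : Continuous fun P => (u P, v P) := hu.cont.prodMk hv.cont
  have c1 := hB.cont_uu.comp hc
  have c2 := hB.cont_uv.comp hc
  refine ⟨hB.cont_u.comp hc, (c1.mul hu.contx).add (c2.mul hv.contx),
    (c1.mul hu.conty).add (c2.mul hv.conty), fun x y => hB.deriv_u (hu.dx x y) (hv.dx x y),
    fun x y => hB.deriv_u (hu.dy x y) (hv.dy x y), fun x y => ?_⟩
  simp only [(hu.per x y).1, (hu.per x y).2, (hv.per x y).1, (hv.per x y).2, and_self]

lemma IsBellman.perC1_v (hB : IsBellman r r' B Bu Bv Buu Buv Bvv)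
    {u ux uy v vx vy : ℝ × ℝ → ℝ} (hu : PerC1 u ux uy) (hv : PerC1 v vx vy) :
    PerC1 (fun P => Bv (u P) (v P)) (fun P => Buv (u P) (v P) * ux P + Bvv (u P) (v P) * vx P)
      (fun P => Buv (u P) (v P) * uy P + Bvv (u P) (v P) * vy P) := by
  have hc : Continuous fun P => (u P, v P) := hu.cont.prodMk hv.cont
  have c1 := hB.cont_uv.comp hc
  have c2 := hB.cont_vv.comp hc
  refine ⟨hB.cont_v.comp hc, (c1.mul hu.contx).add (c2.mul hv.contx),
    (c1.mul hu.conty).add (c2.mul hv.conty), fun x y => hB.deriv_v (hu.dx x y) (hv.dx x y),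
    fun x y => hB.deriv_v (hu.dy x y) (hv.dy x y), fun x y => ?_⟩
  simp only [(hu.per x y).1, (hu.per x y).2, (hv.per x y).1, (hv.per x y).2, and_self]

/-- Dissipation of a Bellman function along a pair of heat flows. -/
lemma IsBellman.integral_dissipation_le (hB : IsBellman r r' B Bu Bv Buu Buv Bvv)
    {D D' : HeatMode → HeatMode} (hD : IsDir D) (hD' : IsDir D') (U V : List HeatMode) (t : ℝ) :
    ∫ P in sqM, (Bu (heat U t P) (heat V t P) * heat (U.map lap) t P +
      Bv (heat U t P) (heat V t P) * heat (V.map lap) t P) ≤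
    -(1 / 3 * ∫ P in sqM, |heat (U.map D) t P * heat (V.map D') t P|) := by
  have hu := perC1_heat U t
  have hv := perC1_heat V t
  have h1 := hB.perC1_u hu hv
  have h2 := hB.perC1_v hu hv
  have hX := (h1.mul (perC1_heat (U.map dx) t)).add (h2.mul (perC1_heat (V.map dx) t))
  have hY := (h1.mul (perC1_heat (U.map dy) t)).add (h2.mul (perC1_heat (V.map dy) t))
  have h0 := hX.integral_div hY
  have cl : ∀ L, Continuous (heat L t) := fun L => continuous_heat_time L t
  have i1 : IntegrableOn (fun P => Bu (heat U t P) (heat V t P) * heat (U.map lap) t P +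
      Bv (heat U t P) (heat V t P) * heat (V.map lap) t P) sqM :=
    ((h1.cont.mul (cl _)).add (h2.cont.mul (cl _))).integrableOn_sqM
  have i2 : IntegrableOn (fun P => 1 / 3 * |heat (U.map D) t P * heat (V.map D') t P|) sqM :=
    (continuous_const.mul ((cl _).mul (cl _)).abs).integrableOn_sqM
  rw [le_neg_iff_add_nonpos_left, ← MeasureTheory.integral_const_mul, ← integral_add i2 i1, ← h0]
  refine integral_mono (i2.add i1) (hX.contx.add hY.conty).integrableOn_sqM fun P => ?_
  simp only
  obtain ⟨τ, hτ, hQ⟩ := hB.hess (heat U t P) (heat V t P)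
  have q1 := hQ (heat (U.map dx) t P) (heat (V.map dx) t P)
  have q2 := hQ (heat (U.map dy) t P) (heat (V.map dy) t P)
  rw [← heat_dx_dx_add_heat_dy_dy U, ← heat_dx_dx_add_heat_dy_dy V]
  have hτi : 0 < τ⁻¹ := inv_pos.2 hτ
  have key : ∀ a b : ℝ, 2 * |a * b| ≤ τ * a ^ 2 + τ⁻¹ * b ^ 2 := fun a b => by
    have e : τ * τ⁻¹ = 1 := mul_inv_cancel₀ hτ.ne'
    have h6 : 0 ≤ τ⁻¹ * (τ * |a| - |b|) ^ 2 := by positivity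
    have h7 : τ⁻¹ * (τ * |a| - |b|) ^ 2 =
        (τ * τ⁻¹) * τ * |a| ^ 2 - 2 * (τ * τ⁻¹) * (|a| * |b|) + τ⁻¹ * |b| ^ 2 := by ring
    rw [h7, e, sq_abs, sq_abs] at h6
    rw [abs_mul]
    linarith
  have hk : 2 * |heat (U.map D) t P * heat (V.map D') t P| ≤
      τ * heat (U.map dx) t P ^ 2 + τ⁻¹ * heat (V.map dx) t P ^ 2 +
        (τ * heat (U.map dy) t P ^ 2 + τ⁻¹ * heat (V.map dy) t P ^ 2) := by
    have p1 : 0 ≤ τ * heat (U.map dx) t P ^ 2 := by positivity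
    have p2 : 0 ≤ τ⁻¹ * heat (V.map dx) t P ^ 2 := by positivity
    have p3 : 0 ≤ τ * heat (U.map dy) t P ^ 2 := by positivity
    have p4 : 0 ≤ τ⁻¹ * heat (V.map dy) t P ^ 2 := by positivity
    refine (key _ _).trans ?_
    rcases hD with rfl | rfl <;> rcases hD' with rfl | rfl <;> linarith
  linarith

/-- The bilinear embedding for second order Riesz transforms. -/
lemma IsBellman.abs_integral_le (hB : IsBellman r r' B Bu Bv Buu Buv Bvv)
    {D D' : HeatMode → HeatMode} (hD : IsDir D) (hD' : IsDir D') (L V : List HeatMode) :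
    |∫ P in sqM, heat ((L.map D).map D') 0 P * heat V 0 P| ≤
      6 * ∫ P in sqM, B (heat (L.map lap) 0 P) (heat V 0 P) := by
  set U := L.map lap with hU
  set Z := (L.map D).map D' with hZ
  have hZlap : Z.map lap = (U.map D).map D' := by
    rcases hD with rfl | rfl <;> rcases hD' with rfl | rfl <;>
      simp only [hZ, hU, map_dx_map_lap, map_dy_map_lap]
  have ci : ∀ (M N : List HeatMode) (t : ℝ), IntegrableOn (fun P => heat M t P * heat N t P) sqM :=
    fun M N t => ((continuous_heat_time M t).mul (continuous_heat_time N t)).integrableOn_sqM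
  have key : ∀ σ : ℝ, |σ| = 1 / 6 → 0 ≤ (∫ P in sqM, B (heat U 0 P) (heat V 0 P)) +
      σ * ∫ P in sqM, heat Z 0 P * heat V 0 P := by
    intro σ hσ
    have hder1 := hasDerivAt_setIntegral_sqM (f := fun t P => B (heat U t P) (heat V t P))
      (f' := fun t P => Bu (heat U t P) (heat V t P) * heat (U.map lap) t P +
        Bv (heat U t P) (heat V t P) * heat (V.map lap) t P)
      (hB.cont.comp ((continuous_heat U).prodMk (continuous_heat V)))
      (((hB.cont_u.comp ((continuous_heat U).prodMk (continuous_heat V))).mul (continuous_heat _)).add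
      ((hB.cont_v.comp ((continuous_heat U).prodMk (continuous_heat V))).mul (continuous_heat _)))
      fun t P => hB.deriv (hasDerivAt_heat_dt U P t) (hasDerivAt_heat_dt V P t)
    have hder2 := hasDerivAt_setIntegral_sqM (f := fun t P => heat Z t P * heat V t P)
      (f' := fun t P => heat (Z.map lap) t P * heat V t P + heat Z t P * heat (V.map lap) t P)
      ((continuous_heat Z).mul (continuous_heat V))
      (((continuous_heat _).mul (continuous_heat _)).add ((continuous_heat _).mul (continuous_heat _)))
      fun t P => (hasDerivAt_heat_dt Z P t).mul (hasDerivAt_heat_dt V P t)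
    have hder := fun t => (hder1 t).add ((hder2 t).const_mul σ)
    set Φ : ℝ → ℝ := fun t => (∫ P in sqM, B (heat U t P) (heat V t P)) +
      σ * ∫ P in sqM, heat Z t P * heat V t P with hΦ
    have hanti : Antitone Φ := by
      refine antitone_of_hasDerivAt_nonpos hder fun t => ?_
      have d1 := hB.integral_dissipation_le hD hD' U V t
      have d2 : ∫ P in sqM, (heat (Z.map lap) t P * heat V t P + heat Z t P * heat (V.map lap) t P) =
          -(2 * ∫ P in sqM, heat (U.map D) t P * heat (V.map D') t P) := by
        rw [integral_add (ci _ _ t) (ci _ _ t), integral_heat_mul_lap, hZlap,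
          integral_heat_dir_mul hD']
        ring
      have d3 : |∫ P in sqM, heat (U.map D) t P * heat (V.map D') t P| ≤
          ∫ P in sqM, |heat (U.map D) t P * heat (V.map D') t P| := abs_integral_le_integral_abs
      have d4 := neg_abs_le (σ * ∫ P in sqM, heat (U.map D) t P * heat (V.map D') t P)
      rw [abs_mul, hσ] at d4
      simp only [d2, Pi.zero_apply]
      linarith
    obtain ⟨K, hK⟩ := exists_abs_heat_dir_le_exp hD' (L.map D)
    obtain ⟨K', hK'⟩ := exists_abs_heat_le V
    have hlow : ∀ t, 0 ≤ t → -(1 / 6 * (K * exp (-t) * K')) ≤ Φ 0 := fun t ht => by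
      refine le_trans ?_ (hanti ht)
      have h1 : 0 ≤ ∫ P in sqM, B (heat U t P) (heat V t P) :=
        integral_nonneg fun P => hB.nonneg _ _
      have h2 : |∫ P in sqM, heat Z t P * heat V t P| ≤ K * exp (-t) * K' := by
        have := norm_integral_le_of_norm_le_const (μ := volume.restrict sqM)
          (f := fun P => heat Z t P * heat V t P) (C := K * exp (-t) * K') (.of_forall fun P => by
            rw [norm_mul, norm_eq_abs, norm_eq_abs]
            exact mul_le_mul (hK t ht P) (hK' t ht P) (abs_nonneg _)
              ((abs_nonneg _).trans (hK t ht P)))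
        simpa using this
      have h3 := neg_abs_le (σ * ∫ P in sqM, heat Z t P * heat V t P)
      rw [abs_mul, hσ] at h3
      simp only [hΦ]
      linarith
    have hlim : Filter.Tendsto (fun t => -(1 / 6 * (K * exp (-t) * K'))) Filter.atTop (nhds 0) := by
      have := ((tendsto_exp_neg_atTop_nhds_zero.const_mul K).mul_const K').const_mul (1 / 6) |>.neg
      simpa using this
    exact le_of_tendsto hlim ((Filter.eventually_ge_atTop 0).mono hlow)
  have k1 := key (1 / 6) (by norm_num)
  have k2 := key (-(1 / 6)) (by norm_num)
  rw [abs_le]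
  constructor <;> linarith

end Flow

/-- The bilinear Riesz transform bound on trigonometric polynomials, in additive form. -/
lemma exists_abs_integral_heat_le {r r' : ℝ} (h : r.HolderConjugate r') :
    ∃ C, 0 ≤ C ∧ ∀ D D', IsDir D → IsDir D' → ∀ L V : List HeatMode,
      |∫ P in sqM, heat ((L.map D).map D') 0 P * heat V 0 P| ≤
        C * (1 + (∫ P in sqM, |heat (L.map lap) 0 P| ^ r) + ∫ P in sqM, |heat V 0 P| ^ r') := by
  have main : ∃ B Bu Bv Buu Buv Bvv, IsBellman r r' B Bu Bv Buu Buv Bvv := by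
    rcases le_total 2 r with h2 | h2
    · exact ⟨_, _, _, _, _, _, Bellman.isBellman h h2⟩
    · have : 2 ≤ r' := by
        have h1 := h.lt
        have h3 := h.symm.lt
        have := h.mul_eq_add
        nlinarith
      exact ⟨_, _, _, _, _, _, (Bellman.isBellman h.symm this).swap⟩
  obtain ⟨B, Bu, Bv, Buu, Buv, Bvv, hB⟩ := main
  obtain ⟨C, hC, hbd⟩ := hB.bound
  refine ⟨6 * C, by positivity, fun D D' hD hD' L V => (hB.abs_integral_le hD hD' L V).trans ?_⟩
  rw [mul_assoc]
  refine mul_le_mul_of_nonneg_left ?_ (by norm_num)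
  have cu := continuous_heat_time (L.map lap) 0
  have cv := continuous_heat_time V 0
  have c1 : IntegrableOn (fun P => |heat (L.map lap) 0 P| ^ r) sqM :=
    (cu.abs.rpow_const fun _ => Or.inr h.nonneg).integrableOn_sqM
  have c2 : IntegrableOn (fun P => |heat V 0 P| ^ r') sqM :=
    (cv.abs.rpow_const fun _ => Or.inr h.symm.nonneg).integrableOn_sqM
  have c0 : IntegrableOn (fun _ : ℝ × ℝ => (1 : ℝ)) sqM := integrable_const 1
  calc _ ≤ ∫ P in sqM, C * (1 + |heat (L.map lap) 0 P| ^ r + |heat V 0 P| ^ r') :=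
        integral_mono (hB.cont.comp (cu.prodMk cv)).integrableOn_sqM (((c0.add c1).add c2).const_mul C)
          fun P => hbd _ _
    _ = _ := by
        have c01 : IntegrableOn (fun P => 1 + |heat (L.map lap) 0 P| ^ r) sqM := c0.add c1
        rw [MeasureTheory.integral_const_mul, integral_add c01 c2, integral_add c0 c1]
        simp

/-- A continuous `1`-periodic function on the plane descends to the torus. -/
lemma exists_continuousMap_unitAddTorus {G : ℝ × ℝ → ℝ} (hG : Continuous G)
    (hper : ∀ x y : ℝ, G (x + 1, y) = G (x, y) ∧ G (x, y + 1) = G (x, y)) :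
    ∃ g : C(UnitAddTorus (Fin 2), ℂ), ∀ x y : ℝ, g ![(x : UnitAddCircle), (y : UnitAddCircle)] = G (x, y) := by
  have hx : ∀ (n : ℤ) (x y : ℝ), G (x + n, y) = G (x, y) := fun n x y => by
    have h : Function.Periodic (fun s => G (s, y)) 1 := fun s => (hper s y).1
    simpa using h.int_mul n x
  have hy : ∀ (n : ℤ) (x y : ℝ), G (x, y + n) = G (x, y) := fun n x y => by
    have h : Function.Periodic (fun s => G (x, s)) 1 := fun s => (hper x s).2
    simpa using h.int_mul n y
  have hout : ∀ x : ℝ, ∃ n : ℤ, Quotient.out (x : UnitAddCircle) = x + n := fun x => by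
    have h1 : ((Quotient.out (x : UnitAddCircle) : ℝ) : UnitAddCircle) = (x : UnitAddCircle) :=
      Quotient.out_eq' _
    obtain ⟨n, hn⟩ := (QuotientAddGroup.eq_iff_sub_mem.1 h1)
    exact ⟨n, by simp at hn; linarith⟩
  let g0 : UnitAddTorus (Fin 2) → ℂ := fun t => G (Quotient.out (t 0), Quotient.out (t 1))
  have hg0 : ∀ x y : ℝ, g0 ![(x : UnitAddCircle), (y : UnitAddCircle)] = G (x, y) := fun x y => by
    obtain ⟨n, hn⟩ := hout x
    obtain ⟨m, hm⟩ := hout y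
    change ((G (Quotient.out (x : UnitAddCircle), Quotient.out (y : UnitAddCircle)) : ℝ) : ℂ) = _
    rw [hn, hm, hx, hy]
  have hq : IsOpenQuotientMap (Pi.map fun (_ : Fin 2) (x : ℝ) => (x : UnitAddCircle)) :=
    .piMap fun _ => QuotientAddGroup.isOpenQuotientMap_mk
  refine ⟨⟨g0, hq.continuous_comp_iff.1 ?_⟩, hg0⟩
  have : g0 ∘ (Pi.map fun (_ : Fin 2) (x : ℝ) => (x : UnitAddCircle)) =
      fun s : Fin 2 → ℝ => ((G (s 0, s 1) : ℝ) : ℂ) := by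
    ext s
    rw [← hg0]
    refine congrArg g0 (funext fun i => ?_)
    fin_cases i <;> rfl
  rw [this]
  fun_prop

lemma exists_heat_eq_re {f : C(UnitAddTorus (Fin 2), ℂ)}
    (hf : f ∈ Submodule.span ℂ (range (UnitAddTorus.mFourier (d := Fin 2)))) (c : ℂ) :
    ∃ L : List HeatMode, ∀ x y : ℝ,
      heat L 0 (x, y) = (c * f ![(x : UnitAddCircle), (y : UnitAddCircle)]).re := by
  induction hf using Submodule.span_induction generalizing c with
  | mem f hf =>
    obtain ⟨n, rfl⟩ := hf
    refine ⟨[⟨‖c‖, n 0, n 1, c.arg⟩], fun x y => ?_⟩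
    have h1 : UnitAddTorus.mFourier n ![(x : UnitAddCircle), (y : UnitAddCircle)] =
        Complex.exp ((2 * π * (n 0 * x + n 1 * y) : ℝ) * Complex.I) := by
      simp only [UnitAddTorus.mFourier, ContinuousMap.coe_mk, Fin.prod_univ_two, Matrix.cons_val_zero,
        Matrix.cons_val_one, fourier_coe_apply, ← Complex.exp_add]
      congr 1
      push_cast
      ring
    have h2 : c * Complex.exp ((2 * π * (n 0 * x + n 1 * y) : ℝ) * Complex.I) =
        ‖c‖ * Complex.exp ((2 * π * (n 0 * x + n 1 * y) + c.arg : ℝ) * Complex.I) := by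
      nth_rewrite 1 [← Complex.norm_mul_exp_arg_mul_I c]
      rw [mul_assoc, ← Complex.exp_add]
      push_cast
      ring_nf
    rw [h1, h2, Complex.re_ofReal_mul, Complex.exp_ofReal_mul_I_re]
    simp [heat, eval]
  | zero => exact ⟨[], by simp [heat_nil]⟩
  | add f g _ _ hf hg =>
    obtain ⟨L, hL⟩ := hf c
    obtain ⟨L', hL'⟩ := hg c
    exact ⟨L ++ L', fun x y => by rw [heat_append, hL, hL']; simp [mul_add]⟩
  | smul b f _ hf =>
    obtain ⟨L, hL⟩ := hf (c * b)
    exact ⟨L, fun x y => by rw [hL]; simp only [ContinuousMap.smul_apply, smul_eq_mul, mul_assoc]⟩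

lemma exists_abs_heat_sub_le {G : ℝ × ℝ → ℝ} (hG : Continuous G)
    (hper : ∀ x y : ℝ, G (x + 1, y) = G (x, y) ∧ G (x, y + 1) = G (x, y)) {ε : ℝ} (hε : 0 < ε) :
    ∃ L : List HeatMode, ∀ P, |heat L 0 P - G P| ≤ ε := by
  obtain ⟨g, hg⟩ := exists_continuousMap_unitAddTorus hG hper
  have hmem : g ∈ (Submodule.span ℂ (range (UnitAddTorus.mFourier (d := Fin 2)))).topologicalClosure := by
    rw [UnitAddTorus.span_mFourier_closure_eq_top]
    trivial
  obtain ⟨f, hf, hfg⟩ := Metric.mem_closure_iff.1 hmem ε hε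
  obtain ⟨L, hL⟩ := exists_heat_eq_re hf 1
  refine ⟨L, fun ⟨x, y⟩ => ?_⟩
  rw [hL, one_mul]
  have h1 := (ContinuousMap.dist_apply_le_dist (f := g) (g := f) ![(x : UnitAddCircle), (y : UnitAddCircle)]).trans hfg.le
  rw [hg, dist_comm, dist_eq_norm] at h1
  have h2 := (Complex.abs_re_le_norm _).trans h1
  simpa using h2

/-- A continuous periodic function is a bounded pointwise limit of trigonometric polynomials. -/
lemma exists_seq_heat {G : ℝ × ℝ → ℝ} (hG : Continuous G)
    (hper : ∀ x y : ℝ, G (x + 1, y) = G (x, y) ∧ G (x, y + 1) = G (x, y)) :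
    ∃ (L : ℕ → List HeatMode) (K : ℝ),
      (∀ P, Filter.Tendsto (fun n => heat (L n) 0 P) Filter.atTop (nhds (G P))) ∧
      ∀ n, ∀ P ∈ sqM, |heat (L n) 0 P| ≤ K := by
  choose L hL using fun n : ℕ => exists_abs_heat_sub_le hG hper (Nat.one_div_pos_of_nat (α := ℝ) (n := n))
  obtain ⟨K, hK⟩ := isCompact_unitSquare.exists_bound_of_continuousOn hG.continuousOn
  refine ⟨L, K + 1, fun P => ?_, fun n P hP => ?_⟩
  · rw [tendsto_iff_norm_sub_tendsto_zero]
    exact squeeze_zero (fun _ => norm_nonneg _) (fun n => hL n P) tendsto_one_div_add_atTop_nhds_zero_nat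
  · have h1 := hL n P
    have h2 := hK P (sqM_subset hP)
    have h3 : (1 : ℝ) / (n + 1) ≤ 1 := by
      rw [div_le_one (by positivity)]
      linarith [(Nat.cast_nonneg n : (0 : ℝ) ≤ n)]
    have h4 : |heat (L n) 0 P| ≤ |heat (L n) 0 P - G P| + |G P| := by
      simpa using abs_add_le (heat (L n) 0 P - G P) (G P)
    rw [norm_eq_abs] at h2
    linarith

lemma tendsto_integral_comp_heat {G : ℝ × ℝ → ℝ} {L : ℕ → List HeatMode} {K : ℝ}
    (hL : ∀ P, Filter.Tendsto (fun n => heat (L n) 0 P) Filter.atTop (nhds (G P)))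
    (hK : ∀ n, ∀ P ∈ sqM, |heat (L n) 0 P| ≤ K) {Φ : (ℝ × ℝ) × ℝ → ℝ} (hΦ : Continuous Φ) :
    Filter.Tendsto (fun n => ∫ P in sqM, Φ (P, heat (L n) 0 P)) Filter.atTop
      (nhds (∫ P in sqM, Φ (P, G P))) := by
  obtain ⟨C, hC⟩ := (isCompact_unitSquare.prod (isCompact_Icc (a := -K) (b := K))).exists_bound_of_continuousOn
    hΦ.continuousOn
  refine tendsto_integral_of_dominated_convergence (fun _ => C) (fun n => ?_) (integrable_const C)
    (fun n => ?_) (.of_forall fun P => ?_)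
  · exact (hΦ.comp (continuous_id.prodMk (continuous_heat_time (L n) 0))).aestronglyMeasurable
  · filter_upwards [ae_restrict_mem measurableSet_sqM] with P hP
    exact hC _ ⟨sqM_subset hP, abs_le.1 (hK n P hP)⟩
  · exact (hΦ.tendsto _).comp (tendsto_const_nhds.prodMk_nhds (hL P))

lemma exists_abs_integral_heat_mul_le {r r' : ℝ} (h : r.HolderConjugate r') :
    ∃ C, 0 ≤ C ∧ ∀ D D', IsDir D → IsDir D' → ∀ (L : List HeatMode) (f : ℝ × ℝ → ℝ), Continuous f →
      (∀ x y : ℝ, f (x + 1, y) = f (x, y) ∧ f (x, y + 1) = f (x, y)) →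
      |∫ P in sqM, heat ((L.map D).map D') 0 P * f P| ≤
        C * (1 + (∫ P in sqM, |heat (L.map lap) 0 P| ^ r) + ∫ P in sqM, |f P| ^ r') := by
  obtain ⟨C, hC, hbd⟩ := exists_abs_integral_heat_le h
  refine ⟨C, hC, fun D D' hD hD' L f hf hper => ?_⟩
  obtain ⟨V, K, hV, hK⟩ := exists_seq_heat hf hper
  have t1 := tendsto_integral_comp_heat hV hK
    (Φ := fun p => heat ((L.map D).map D') 0 p.1 * p.2)
    (((continuous_heat_time _ 0).comp continuous_fst).mul continuous_snd)
  have t2 := tendsto_integral_comp_heat hV hK (Φ := fun p => |p.2| ^ r')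
    (continuous_snd.abs.rpow_const fun _ => Or.inr h.symm.nonneg)
  exact le_of_tendsto_of_tendsto' t1.abs ((t2.const_add _).const_mul C) fun n => hbd D D' hD hD' L (V n)

lemma le_mul_rpow_mul_rpow_of_scaled {r r' X C A B : ℝ} (h : r.HolderConjugate r') (hC : 0 ≤ C)
    (hA : 0 ≤ A) (hB : 0 ≤ B)
    (H : ∀ s t : ℝ, 0 < s → 0 < t → s * t * X ≤ C * (1 + s ^ r * A + t ^ r' * B)) :
    X ≤ 3 * C * (A ^ (1 / r) * B ^ (1 / r')) := by
  have key : ∀ {ρ Y η : ℝ}, 0 < ρ → 0 ≤ Y → 0 < η → (Y ^ (1 / ρ) + η)⁻¹ ^ ρ * Y ≤ 1 := by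
    intro ρ Y η hρ hY hη
    have h0 : 0 ≤ Y ^ (1 / ρ) := by positivity
    have h1 : Y = (Y ^ (1 / ρ)) ^ ρ := by
      rw [← rpow_mul hY, one_div_mul_cancel hρ.ne', rpow_one]
    nth_rewrite 2 [h1]
    rw [← mul_rpow (by positivity) h0]
    refine rpow_le_one (by positivity) ?_ hρ.le
    rw [inv_mul_le_one₀ (by positivity)]
    linarith
  have lim : Filter.Tendsto (fun η : ℝ => 3 * C * ((A ^ (1 / r) + η) * (B ^ (1 / r') + η)))
      (nhdsWithin 0 (Ioi 0)) (nhds (3 * C * ((A ^ (1 / r) + 0) * (B ^ (1 / r') + 0)))) :=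
    (Continuous.tendsto (by fun_prop) 0).mono_left nhdsWithin_le_nhds
  simp only [add_zero] at lim
  refine ge_of_tendsto lim ?_
  filter_upwards [self_mem_nhdsWithin] with η hη
  have hη : 0 < η := hη
  have ha : 0 < A ^ (1 / r) + η := by positivity
  have hb : 0 < B ^ (1 / r') + η := by positivity
  have := H _ _ (inv_pos.2 ha) (inv_pos.2 hb)
  have k1 := key h.pos hA hη
  have k2 := key h.symm.pos hB hη
  have h3 : (A ^ (1 / r) + η)⁻¹ * (B ^ (1 / r') + η)⁻¹ * X ≤ 3 * C := by
    refine this.trans ?_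
    nlinarith
  rw [← mul_inv, inv_mul_le_iff₀ (by positivity)] at h3
  linarith

lemma IsDir.map_scale {D : HeatMode → HeatMode} (hD : IsDir D) (s : ℝ) (L : List HeatMode) :
    (L.map (scale s)).map D = (L.map D).map (scale s) := by
  have : ∀ a, D (scale s a) = scale s (D a) := fun a => by
    rcases hD with rfl | rfl <;> ext <;> simp [dx, dy, scale, mul_assoc]
  simp [this]

lemma map_lap_map_scale (s : ℝ) (L : List HeatMode) :
    (L.map (scale s)).map lap = (L.map lap).map (scale s) := by
  have : ∀ a, lap (scale s a) = scale s (lap a) := fun a => by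
    ext <;> simp [lap, scale, eig, mul_assoc]
  simp [this]

/-- The mean value of a function is controlled by its `L^r` norm. -/
lemma abs_integral_rpow_le {r : ℝ} (hr : 1 ≤ r) {f : ℝ × ℝ → ℝ} (hf : Continuous f) :
    |∫ P in sqM, f P| ^ r ≤ ∫ P in sqM, |f P| ^ r := by
  have hr0 : 0 ≤ r := by linarith
  refine (rpow_le_rpow (abs_nonneg _) abs_integral_le_integral_abs hr0).trans ?_
  exact (convexOn_rpow hr).map_integral_le (continuous_id.rpow_const fun _ => Or.inr hr0).continuousOn
    isClosed_Ici (.of_forall fun P => abs_nonneg (f P)) hf.abs.integrableOn_sqM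
    (hf.abs.rpow_const fun _ => Or.inr hr0).integrableOn_sqM

lemma integral_abs_sub_mean_rpow_le {r : ℝ} (hr : 1 ≤ r) {f : ℝ × ℝ → ℝ} (hf : Continuous f) :
    (∫ P in sqM, |f P - ∫ Q in sqM, f Q| ^ r) ^ (1 / r) ≤ 4 * (∫ P in sqM, |f P| ^ r) ^ (1 / r) := by
  set m := ∫ Q in sqM, f Q with hm
  have hr0 : 0 < r := by linarith
  have hJ := abs_integral_rpow_le hr hf
  rw [← hm] at hJ
  have pt : ∀ a : ℝ, |a - m| ^ r ≤ 2 ^ r * |a| ^ r + 2 ^ r * |m| ^ r := fun a => by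
    have h1 : |a - m| ≤ 2 * max |a| |m| := by
      have := abs_sub a m
      linarith [le_max_left |a| |m|, le_max_right |a| |m|]
    refine (rpow_le_rpow (abs_nonneg _) h1 hr0.le).trans ?_
    rw [mul_rpow (by norm_num) (le_max_of_le_left (abs_nonneg _))]
    have p1 : 0 ≤ 2 ^ r * |a| ^ r := by positivity
    have p2 : 0 ≤ 2 ^ r * |m| ^ r := by positivity
    rcases max_choice |a| |m| with e | e <;> rw [e] <;> linarith
  have c1 : IntegrableOn (fun P => 2 ^ r * |f P| ^ r) sqM :=
    (continuous_const.mul (hf.abs.rpow_const fun _ => Or.inr hr0.le)).integrableOn_sqM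
  have c2 : IntegrableOn (fun _ : ℝ × ℝ => 2 ^ r * |m| ^ r) sqM := integrable_const _
  have h1 : ∫ P in sqM, |f P - m| ^ r ≤ 4 ^ r * ∫ P in sqM, |f P| ^ r := by
    calc _ ≤ ∫ P in sqM, (2 ^ r * |f P| ^ r + 2 ^ r * |m| ^ r) :=
          integral_mono ((hf.sub continuous_const).abs.rpow_const fun _ => Or.inr hr0.le).integrableOn_sqM
            (c1.add c2) fun P => pt _
      _ = 2 ^ r * (∫ P in sqM, |f P| ^ r) + 2 ^ r * |m| ^ r := by
          rw [integral_add c1 c2, MeasureTheory.integral_const_mul]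
          simp
      _ ≤ 2 ^ r * (2 * ∫ P in sqM, |f P| ^ r) := by
          have : (0 : ℝ) ≤ 2 ^ r := by positivity
          nlinarith
      _ ≤ 2 ^ r * (2 ^ r * ∫ P in sqM, |f P| ^ r) := by
          have h0 : 0 ≤ ∫ P in sqM, |f P| ^ r := integral_nonneg fun P => by positivity
          have h2 : (2 : ℝ) ≤ 2 ^ r := self_le_rpow_of_one_le (by norm_num) hr
          gcongr
      _ = _ := by
          rw [← mul_assoc, ← mul_rpow (by norm_num) (by norm_num)]
          norm_num
  have h0 : 0 ≤ ∫ P in sqM, |f P| ^ r := integral_nonneg fun P => by positivity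
  have h00 : 0 ≤ ∫ P in sqM, |f P - m| ^ r := integral_nonneg fun P => by positivity
  calc _ ≤ (4 ^ r * ∫ P in sqM, |f P| ^ r) ^ (1 / r) := rpow_le_rpow h00 h1 (by positivity)
    _ = _ := by
        rw [mul_rpow (by positivity) h0, ← rpow_mul (by norm_num), mul_one_div_cancel hr0.ne', rpow_one]

/-- Boundedness of the second order Riesz transforms, tested against trigonometric polynomials. -/
lemma exists_abs_integral_invLap_le {r r' : ℝ} (h : r.HolderConjugate r') :
    ∃ C, 0 ≤ C ∧ ∀ D D', IsDir D → IsDir D' → ∀ (L : List HeatMode) (f : ℝ × ℝ → ℝ), Continuous f →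
      (∀ x y : ℝ, f (x + 1, y) = f (x, y) ∧ f (x, y + 1) = f (x, y)) →
      |∫ P in sqM, heat (((L.map invLap).map D).map D') 0 P * f P| ≤
        C * ((∫ P in sqM, |heat L 0 P| ^ r) ^ (1 / r) * (∫ P in sqM, |f P| ^ r') ^ (1 / r')) := by
  obtain ⟨C, hC, hbd⟩ := exists_abs_integral_heat_mul_le h
  refine ⟨12 * C, by positivity, fun D D' hD hD' L f hf hper => ?_⟩
  have hA : 0 ≤ ∫ P in sqM, |heat ((L.map invLap).map lap) 0 P| ^ r :=
    integral_nonneg fun P => by positivity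
  have hB : 0 ≤ ∫ P in sqM, |f P| ^ r' := integral_nonneg fun P => by positivity
  have h1 := le_mul_rpow_mul_rpow_of_scaled h hC hA hB
    (X := |∫ P in sqM, heat (((L.map invLap).map D).map D') 0 P * f P|) fun s t hs ht => by
      have := hbd D D' hD hD' ((L.map invLap).map (scale s)) (fun P => t * f P)
        (continuous_const.mul hf) fun x y => by simp only [(hper x y).1, (hper x y).2, and_self]
      simp only [hD.map_scale, hD'.map_scale, map_lap_map_scale, heat_scale, abs_mul, abs_of_pos hs,
        abs_of_pos ht, mul_rpow hs.le (abs_nonneg _), mul_rpow ht.le (abs_nonneg _),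
        MeasureTheory.integral_const_mul, mul_mul_mul_comm s _ t] at this
      simpa [abs_mul, abs_of_pos hs, abs_of_pos ht] using this
  have h2 := integral_abs_sub_mean_rpow_le h.lt.le (continuous_heat_time L 0)
  simp only [← heat_invLap_lap] at h2
  refine h1.trans ?_
  have h3 : 0 ≤ (∫ P in sqM, |f P| ^ r') ^ (1 / r') := by positivity
  calc _ ≤ 3 * C * ((4 * (∫ P in sqM, |heat L 0 P| ^ r) ^ (1 / r)) *
        (∫ P in sqM, |f P| ^ r') ^ (1 / r')) := by gcongr
    _ = _ := by ring

/-- Smooth functions on the infinite layer which are `1`-periodic in the horizontal variables. -/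
structure SmoothPer (g : ℝ × ℝ × ℝ → ℝ) : Prop where
  smooth : ContDiff ℝ (⊤ : ℕ∞) g
  per : ∀ x y z : ℝ, g (x + 1, y, z) = g (x, y, z) ∧ g (x, y + 1, z) = g (x, y, z)

namespace SmoothPer

variable {f g : ℝ × ℝ × ℝ → ℝ}

lemma differentiable (hg : SmoothPer g) : Differentiable ℝ g :=
  hg.smooth.differentiable (by simp)

lemma mul (hf : SmoothPer f) (hg : SmoothPer g) : SmoothPer fun p => f p * g p where
  smooth := hf.smooth.mul hg.smooth
  per x y z := by
    simp only [(hf.per x y z).1, (hf.per x y z).2, (hg.per x y z).1, (hg.per x y z).2, and_self]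

lemma fderiv_per (hg : SmoothPer g) (x y z : ℝ) :
    fderiv ℝ g (x + 1, y, z) = fderiv ℝ g (x, y, z) ∧
      fderiv ℝ g (x, y + 1, z) = fderiv ℝ g (x, y, z) := by
  have h1 : (fun p => g (p + (1, 0, 0))) = g := by
    ext ⟨a, b, c⟩
    simpa using (hg.per a b c).1
  have h2 : (fun p => g (p + (0, 1, 0))) = g := by
    ext ⟨a, b, c⟩
    simpa using (hg.per a b c).2
  constructor
  · conv_rhs => rw [← h1, fderiv_comp_add_right]
    simp
  · conv_rhs => rw [← h2, fderiv_comp_add_right]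
    simp

lemma dX (hg : SmoothPer g) : SmoothPer (dX g) where
  smooth := (hg.smooth.fderiv_right (by simp)).clm_apply contDiff_const
  per x y z := by simp only [_root_.dX, (hg.fderiv_per x y z).1, (hg.fderiv_per x y z).2, and_self]

lemma dY (hg : SmoothPer g) : SmoothPer (dY g) where
  smooth := (hg.smooth.fderiv_right (by simp)).clm_apply contDiff_const
  per x y z := by simp only [_root_.dY, (hg.fderiv_per x y z).1, (hg.fderiv_per x y z).2, and_self]

lemma dX_mul (hf : SmoothPer f) (hg : SmoothPer g) (p : ℝ × ℝ × ℝ) :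
    _root_.dX (fun p => f p * g p) p = f p * _root_.dX g p + g p * _root_.dX f p := by
  simp [_root_.dX, fderiv_fun_mul hf.differentiable.differentiableAt hg.differentiable.differentiableAt]

lemma dY_mul (hf : SmoothPer f) (hg : SmoothPer g) (p : ℝ × ℝ × ℝ) :
    _root_.dY (fun p => f p * g p) p = f p * _root_.dY g p + g p * _root_.dY f p := by
  simp [_root_.dY, fderiv_fun_mul hf.differentiable.differentiableAt hg.differentiable.differentiableAt]

end SmoothPer

/-- The vertical average over `(-h, h)`. -/
def vertAvg (h : ℝ) (g : ℝ × ℝ × ℝ → ℝ) (P : ℝ × ℝ) : ℝ :=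
  (1 / (2 * h)) * ∫ z in (-h)..h, g (P.1, P.2, z)

lemma avg_eq_vertAvg (h : ℝ) (f g : ℝ × ℝ × ℝ → ℝ) : avg h f g = vertAvg h fun p => f p * g p := rfl

lemma continuous_vertAvg (h : ℝ) {g : ℝ × ℝ × ℝ → ℝ} (hg : Continuous g) :
    Continuous (vertAvg h g) := by
  unfold vertAvg
  refine continuous_const.mul (continuous_parametric_intervalIntegral_of_continuous' ?_ _ _)
  exact hg.comp (by fun_prop : Continuous fun p : (ℝ × ℝ) × ℝ => (p.1.1, p.1.2, p.2))

/-- The inclusion of horizontal vectors. -/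
def horizIncl : ℝ × ℝ →L[ℝ] ℝ × ℝ × ℝ :=
  (ContinuousLinearMap.fst ℝ ℝ ℝ).prod ((ContinuousLinearMap.snd ℝ ℝ ℝ).prod 0)

lemma SmoothPer.hasFDerivAt_vertAvg {g : ℝ × ℝ × ℝ → ℝ} (hg : SmoothPer g) (h : ℝ) (P : ℝ × ℝ) :
    HasFDerivAt (vertAvg h g)
      ((1 / (2 * h)) • ∫ z in (-h)..h, (fderiv ℝ g (P.1, P.2, z)).comp horizIncl) P := by
  have hι : Continuous fun p : (ℝ × ℝ) × ℝ => (p.1.1, p.1.2, p.2) := by fun_prop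
  have hc : Continuous fun p : (ℝ × ℝ) × ℝ => (fderiv ℝ g (p.1.1, p.1.2, p.2)).comp horizIncl :=
    ((hg.smooth.continuous_fderiv (by simp)).comp hι).clm_comp continuous_const
  obtain ⟨C, hC⟩ := ((isCompact_closedBall P 1).prod (isCompact_uIcc (a := -h) (b := h))
    ).exists_bound_of_continuousOn hc.continuousOn
  have hP : ∀ Q : ℝ × ℝ, Continuous fun z : ℝ => (Q, z) := fun Q => by fun_prop
  have := hasFDerivAt_integral_of_dominated_of_fderiv_le (μ := volume) (a := -h) (b := h)
    (F := fun (Q : ℝ × ℝ) z => g (Q.1, Q.2, z))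
    (F' := fun (Q : ℝ × ℝ) z => (fderiv ℝ g (Q.1, Q.2, z)).comp horizIncl)
    (bound := fun _ => C) (Metric.ball_mem_nhds P one_pos)
    (.of_forall fun Q => ((hg.smooth.continuous.comp hι).comp (hP Q)).aestronglyMeasurable)
    (((hg.smooth.continuous.comp hι).comp (hP P)).intervalIntegrable _ _)
    (hc.comp (hP P)).aestronglyMeasurable
    (.of_forall fun z hz Q hQ => hC (Q, z) ⟨Metric.ball_subset_closedBall hQ, uIoc_subset_uIcc hz⟩)
    (intervalIntegrable_const)
    (.of_forall fun z _ Q _ => by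
      have h1 : HasFDerivAt (fun Q : ℝ × ℝ => (Q.1, Q.2, z)) horizIncl Q :=
        hasFDerivAt_fst.prodMk (hasFDerivAt_snd.prodMk (hasFDerivAt_const z Q))
      exact (hg.differentiable _).hasFDerivAt.comp Q h1)
  exact this.const_mul _

lemma SmoothPer.fderiv_vertAvg_apply {g : ℝ × ℝ × ℝ → ℝ} (hg : SmoothPer g) (h : ℝ) (P w : ℝ × ℝ) :
    fderiv ℝ (vertAvg h g) P w = vertAvg h (fun p => fderiv ℝ g p (w.1, w.2, 0)) P := by
  rw [(hg.hasFDerivAt_vertAvg h P).fderiv]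
  have hc : Continuous fun z : ℝ => (fderiv ℝ g (P.1, P.2, z)).comp horizIncl :=
    ((hg.smooth.continuous_fderiv (by simp)).comp
      (by fun_prop : Continuous fun z : ℝ => (P.1, P.2, z))).clm_comp continuous_const
  rw [smul_apply,
    ContinuousLinearMap.intervalIntegral_apply (hc.intervalIntegrable _ _)]
  rfl

lemma SmoothPer.d2X_vertAvg {g : ℝ × ℝ × ℝ → ℝ} (hg : SmoothPer g) (h : ℝ) :
    d2X (vertAvg h g) = vertAvg h (_root_.dX g) :=
  funext fun P => hg.fderiv_vertAvg_apply h P (1, 0)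

lemma SmoothPer.d2Y_vertAvg {g : ℝ × ℝ × ℝ → ℝ} (hg : SmoothPer g) (h : ℝ) :
    d2Y (vertAvg h g) = vertAvg h (_root_.dY g) :=
  funext fun P => hg.fderiv_vertAvg_apply h P (0, 1)

/-- A differentiable periodic function with continuous `d2X`, `d2Y` has these as partials. -/
lemma perC1_of_differentiable {G : ℝ × ℝ → ℝ} (hG : Differentiable ℝ G) (hx : Continuous (d2X G))
    (hy : Continuous (d2Y G))
    (hper : ∀ x y : ℝ, G (x + 1, y) = G (x, y) ∧ G (x, y + 1) = G (x, y)) :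
    PerC1 G (d2X G) (d2Y G) where
  cont := hG.continuous
  contx := hx
  conty := hy
  dx x y := (hG (x, y)).hasFDerivAt.comp_hasDerivAt x ((hasDerivAt_id x).prodMk (hasDerivAt_const x y))
  dy x y := (hG (x, y)).hasFDerivAt.comp_hasDerivAt y ((hasDerivAt_const y x).prodMk (hasDerivAt_id y))
  per := hper

lemma SmoothPer.perC1_vertAvg {g : ℝ × ℝ × ℝ → ℝ} (hg : SmoothPer g) (h : ℝ) :
    PerC1 (vertAvg h g) (vertAvg h (_root_.dX g)) (vertAvg h (_root_.dY g)) := by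
  have := perC1_of_differentiable (fun P => (hg.hasFDerivAt_vertAvg h P).differentiableAt)
    (hg.d2X_vertAvg h ▸ continuous_vertAvg h hg.dX.smooth.continuous)
    (hg.d2Y_vertAvg h ▸ continuous_vertAvg h hg.dY.smooth.continuous)
    fun x y => by simp only [vertAvg, (hg.per x y _).1, (hg.per x y _).2, and_self]
  rwa [hg.d2X_vertAvg, hg.d2Y_vertAvg] at this

lemma ContDiff.d2X {G : ℝ × ℝ → ℝ} (hG : ContDiff ℝ (⊤ : ℕ∞) G) : ContDiff ℝ (⊤ : ℕ∞) (d2X G) :=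
  (hG.fderiv_right (by simp)).clm_apply contDiff_const

lemma ContDiff.d2Y {G : ℝ × ℝ → ℝ} (hG : ContDiff ℝ (⊤ : ℕ∞) G) : ContDiff ℝ (⊤ : ℕ∞) (d2Y G) :=
  (hG.fderiv_right (by simp)).clm_apply contDiff_const

lemma ContDiff.perC1 {G : ℝ × ℝ → ℝ} (hG : ContDiff ℝ (⊤ : ℕ∞) G)
    (hper : ∀ x y : ℝ, G (x + 1, y) = G (x, y) ∧ G (x, y + 1) = G (x, y)) :
    PerC1 G (_root_.d2X G) (_root_.d2Y G) :=
  perC1_of_differentiable (hG.differentiable (by simp)) hG.d2X.continuous hG.d2Y.continuous hper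

lemma fderiv_per {G : ℝ × ℝ → ℝ}
    (hper : ∀ x y : ℝ, G (x + 1, y) = G (x, y) ∧ G (x, y + 1) = G (x, y)) (x y : ℝ) :
    fderiv ℝ G (x + 1, y) = fderiv ℝ G (x, y) ∧ fderiv ℝ G (x, y + 1) = fderiv ℝ G (x, y) := by
  have h1 : (fun p => G (p + (1, 0))) = G := by
    ext ⟨a, b⟩
    simpa using (hper a b).1
  have h2 : (fun p => G (p + (0, 1))) = G := by
    ext ⟨a, b⟩
    simpa using (hper a b).2
  constructor
  · conv_rhs => rw [← h1, fderiv_comp_add_right]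
    simp
  · conv_rhs => rw [← h2, fderiv_comp_add_right]
    simp

/-- The pressure equation `-Δp = ∂ₓ f₁ + ∂ᵧ f₂` for continuously differentiable periodic data. -/
structure PressureEq (p px py f₁ f₂ : ℝ × ℝ → ℝ) : Prop where
  perC1 : PerC1 p px py
  exists_eq : ∃ pxx pxy pyx pyy f₁x f₁y f₂x f₂y, PerC1 px pxx pxy ∧ PerC1 py pyx pyy ∧
    PerC1 f₁ f₁x f₁y ∧ PerC1 f₂ f₂x f₂y ∧ ∀ P, -(pxx P + pyy P) = f₁x P + f₂y P

namespace PressureEq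

variable {p px py f₁ f₂ : ℝ × ℝ → ℝ}

/-- The energy estimate. -/
lemma integral_grad_sq_le (hp : PressureEq p px py f₁ f₂) :
    ∫ P in sqM, (px P ^ 2 + py P ^ 2) ≤ ∫ P in sqM, (f₁ P ^ 2 + f₂ P ^ 2) := by
  obtain ⟨h, pxx, pxy, pyx, pyy, f₁x, f₁y, f₂x, f₂y, hx, hy, h1, h2, heq⟩ := hp
  have h0 := ((h.mul hx).add (h.mul h1)).integral_div ((h.mul hy).add (h.mul h2))
  have i0 : IntegrableOn (fun P => 2 * (px P * px P + p P * pxx P + (px P * f₁ P + p P * f₁x P) +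
      (py P * py P + p P * pyy P + (py P * f₂ P + p P * f₂y P)))) sqM :=
    (continuous_const.mul (((h.mul hx).add (h.mul h1)).contx.add
      ((h.mul hy).add (h.mul h2)).conty)).integrableOn_sqM
  have i1 : IntegrableOn (fun P => f₁ P ^ 2 + f₂ P ^ 2) sqM :=
    ((h1.cont.pow 2).add (h2.cont.pow 2)).integrableOn_sqM
  calc _ ≤ ∫ P in sqM, (2 * (px P * px P + p P * pxx P + (px P * f₁ P + p P * f₁x P) +
        (py P * py P + p P * pyy P + (py P * f₂ P + p P * f₂y P))) + (f₁ P ^ 2 + f₂ P ^ 2)) := by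
        refine integral_mono ((h.contx.pow 2).add (h.conty.pow 2)).integrableOn_sqM (i0.add i1)
          fun P => ?_
        have e : p P * pxx P + p P * f₁x P + p P * pyy P + p P * f₂y P = 0 := by
          linear_combination -p P * heq P
        have s1 := sq_nonneg (px P + f₁ P)
        have s2 := sq_nonneg (py P + f₂ P)
        simp only
        linarith
    _ = _ := by
        rw [integral_add i0 i1, MeasureTheory.integral_const_mul, h0, mul_zero, zero_add]

lemma integral_mul_heat_lap (hp : PressureEq p px py f₁ f₂) (M : List HeatMode) :
    ∫ P in sqM, p P * heat (M.map lap) 0 P =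
      (∫ P in sqM, f₁ P * heat (M.map dx) 0 P) + ∫ P in sqM, f₂ P * heat (M.map dy) 0 P := by
  obtain ⟨h, pxx, pxy, pyx, pyy, f₁x, f₁y, f₂x, f₂y, hx, hy, h1, h2, heq⟩ := hp
  have hM := perC1_heat M 0
  have e1 := (h.mul (perC1_heat (M.map dx) 0)).integral_div (h.mul (perC1_heat (M.map dy) 0))
  have e2 := ((hx.mul hM).add (h1.mul hM)).integral_div ((hy.mul hM).add (h2.mul hM))
  have c := continuous_heat_time
  have i1 : IntegrableOn (fun P => p P * heat (M.map lap) 0 P) sqM := (h.cont.mul (c _ 0)).integrableOn_sqM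
  have i2 : IntegrableOn (fun P => f₁ P * heat (M.map dx) 0 P) sqM := (h1.cont.mul (c _ 0)).integrableOn_sqM
  have i3 : IntegrableOn (fun P => f₂ P * heat (M.map dy) 0 P) sqM := (h2.cont.mul (c _ 0)).integrableOn_sqM
  have i23 : IntegrableOn (fun P => f₁ P * heat (M.map dx) 0 P + f₂ P * heat (M.map dy) 0 P) sqM := i2.add i3
  rw [← integral_add i2 i3, ← sub_eq_zero, ← integral_sub i1 i23]
  have e3 := (integral_sub
    ((h.mul (perC1_heat (M.map dx) 0)).contx.add (h.mul (perC1_heat (M.map dy) 0)).conty).integrableOn_sqM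
    (((hx.mul hM).add (h1.mul hM)).contx.add ((hy.mul hM).add (h2.mul hM)).conty).integrableOn_sqM).trans
    (sub_eq_zero.2 (e1.trans e2.symm))
  refine Eq.trans (setIntegral_congr_fun measurableSet_sqM fun P _ => ?_) e3
  simp only [← heat_dx_dx_add_heat_dy_dy, Pi.add_apply]
  linear_combination (-heat M 0 P) * heq P

end PressureEq

lemma PerC1.integral_dx_mul_heat {A Ax Ay : ℝ × ℝ → ℝ} (hA : PerC1 A Ax Ay) (M : List HeatMode) :
    ∫ P in sqM, Ax P * heat M 0 P = -∫ P in sqM, A P * heat (M.map HeatMode.dx) 0 P := by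
  have c := continuous_heat_time
  have h1 := integral_add (hA.contx.mul (c M 0)).integrableOn_sqM
    (hA.cont.mul (c (M.map HeatMode.dx) 0)).integrableOn_sqM
  rw [eq_neg_iff_add_eq_zero]
  exact h1.symm.trans (hA.mul (perC1_heat M 0)).integral_dx

lemma PerC1.integral_dy_mul_heat {A Ax Ay : ℝ × ℝ → ℝ} (hA : PerC1 A Ax Ay) (M : List HeatMode) :
    ∫ P in sqM, Ay P * heat M 0 P = -∫ P in sqM, A P * heat (M.map HeatMode.dy) 0 P := by
  have c := continuous_heat_time
  have h1 := integral_add (hA.conty.mul (c M 0)).integrableOn_sqM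
    (hA.cont.mul (c (M.map HeatMode.dy) 0)).integrableOn_sqM
  rw [eq_neg_iff_add_eq_zero]
  exact h1.symm.trans (hA.mul (perC1_heat M 0)).integral_dy

/-- The pressure equation satisfied under the hypotheses of the theorem. -/
lemma Hyp15.pressureEq {h : ℝ} {v1 v2 : ℝ × ℝ × ℝ → ℝ} {ps1 : ℝ × ℝ → ℝ} (H : Hyp15 h v1 v2 ps1) :
    PressureEq ps1 (d2X ps1) (d2Y ps1)
      (fun P => vertAvg h (dX fun p => v1 p * v1 p) P + vertAvg h (dY fun p => v1 p * v2 p) P)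
      (fun P => vertAvg h (dX fun p => v2 p * v1 p) P + vertAvg h (dY fun p => v2 p * v2 p) P) := by
  obtain ⟨s1, s2, sp, per1, per2, perp, heq, -⟩ := H
  have h1 : SmoothPer v1 := ⟨s1, per1⟩
  have h2 : SmoothPer v2 := ⟨s2, per2⟩
  have perx : ∀ x y : ℝ, d2X ps1 (x + 1, y) = d2X ps1 (x, y) ∧ d2X ps1 (x, y + 1) = d2X ps1 (x, y) :=
    fun x y => by simp only [d2X, (fderiv_per perp x y).1, (fderiv_per perp x y).2, and_self]
  have pery : ∀ x y : ℝ, d2Y ps1 (x + 1, y) = d2Y ps1 (x, y) ∧ d2Y ps1 (x, y + 1) = d2Y ps1 (x, y) :=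
    fun x y => by simp only [d2Y, (fderiv_per perp x y).1, (fderiv_per perp x y).2, and_self]
  refine ⟨sp.perC1 perp, _, _, _, _, _, _, _, _, sp.d2X.perC1 perx, sp.d2Y.perC1 pery,
    ((h1.mul h1).dX.perC1_vertAvg h).add ((h1.mul h2).dY.perC1_vertAvg h),
    ((h2.mul h1).dX.perC1_vertAvg h).add ((h2.mul h2).dY.perC1_vertAvg h), fun P => ?_⟩
  have := heq P
  simp only [avg_eq_vertAvg, (h1.mul h1).d2X_vertAvg, (h1.mul h1).dX.d2X_vertAvg,
    (h1.mul h2).d2Y_vertAvg, (h1.mul h2).dY.d2X_vertAvg, (h2.mul h1).d2X_vertAvg,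
    (h2.mul h1).dX.d2Y_vertAvg, (h2.mul h2).d2Y_vertAvg, (h2.mul h2).dY.d2Y_vertAvg] at this
  rw [this]
  ring

lemma integral_sqM_intervalIntegral_swap (h : ℝ) {F : (ℝ × ℝ) → ℝ → ℝ} (hF : Continuous F.uncurry) :
    ∫ P in sqM, (∫ z in (-h)..h, F P z) = ∫ z in (-h)..h, (∫ P in sqM, F P z) := by
  rw [intervalIntegral_integral_swap (f := fun z P => F P z)]
  rw [Measure.prod_restrict, ← Measure.volume_eq_prod]
  exact (((hF.comp continuous_swap).continuousOn.integrableOn_compact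
    ((isCompact_uIcc (a := -h) (b := h)).prod isCompact_unitSquare))).mono_set
    (prod_mono uIoc_subset_uIcc sqM_subset)

lemma continuous_setIntegral_sqM {F : ℝ → ℝ × ℝ → ℝ} (hF : Continuous F.uncurry) :
    Continuous fun z => ∫ P in sqM, F z P := by
  have h1 : ∀ z, ∫ P in sqM, F z P = ∫ x in (0 : ℝ)..1, ∫ y in (0 : ℝ)..1, F z (x, y) := fun z =>
    setIntegral_sqM (hF.comp (by fun_prop : Continuous fun P : ℝ × ℝ => (z, P)))
  simp only [h1]
  refine continuous_parametric_intervalIntegral_of_continuous' ?_ _ _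
  refine continuous_parametric_intervalIntegral_of_continuous' ?_ _ _
  exact hF.comp (by fun_prop : Continuous fun p : (ℝ × ℝ) × ℝ => (p.1.1, p.1.2, p.2))

lemma continuous_sqrt_rpow {v1 v2 : ℝ × ℝ × ℝ → ℝ} (h1 : Continuous v1) (h2 : Continuous v2) {q : ℝ}
    (hq : 0 ≤ q) : Continuous fun z : ℝ =>
      (∫ xy in sqM, (√((v1 (xy.1, xy.2, z)) ^ 2 + (v2 (xy.1, xy.2, z)) ^ 2)) ^ (2 * q)) ^ (1 / q) := by
  have hc : Continuous fun p : ℝ × ℝ × ℝ => (p.2.1, p.2.2, p.1) := by fun_prop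
  refine (continuous_setIntegral_sqM (F := fun z xy =>
    (√((v1 (xy.1, xy.2, z)) ^ 2 + (v2 (xy.1, xy.2, z)) ^ 2)) ^ (2 * q)) ?_).rpow_const
    fun _ => Or.inr (by positivity)
  exact (((h1.comp hc).pow 2).add ((h2.comp hc).pow 2)).sqrt.rpow_const fun _ => Or.inr (by positivity)

/-- Minkowski's inequality for the vertical average, tested against a family of functions. -/
lemma abs_integral_vertAvg_mul_le {h : ℝ} (hh : 0 < h) {v1 v2 u : ℝ × ℝ × ℝ → ℝ}
    (h1 : Continuous v1) (h2 : Continuous v2) (hu : Continuous u)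
    (huv : ∀ p, |u p| ≤ v1 p ^ 2 + v2 p ^ 2) {q : ℝ} (hq : 0 < q) {H : ℝ × ℝ → ℝ} (hH : Continuous H)
    {K : ℝ} (hK : 0 ≤ K)
    (hbd : ∀ z : ℝ, |∫ xy in sqM, H xy * u (xy.1, xy.2, z)| ≤
      K * (∫ xy in sqM, |u (xy.1, xy.2, z)| ^ q) ^ (1 / q)) :
    |∫ xy in sqM, vertAvg h u xy * H xy| ≤ 1 / (2 * h) * (K * ∫ z in (-h)..h,
      (∫ xy in sqM, (√((v1 (xy.1, xy.2, z)) ^ 2 + (v2 (xy.1, xy.2, z)) ^ 2)) ^ (2 * q)) ^ (1 / q)) := by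
  have hc : Continuous fun p : (ℝ × ℝ) × ℝ => (p.1.1, p.1.2, p.2) := by fun_prop
  have hz : ∀ z : ℝ, Continuous fun P : ℝ × ℝ => (P.1, P.2, z) := fun z => by fun_prop
  have e : ∫ xy in sqM, vertAvg h u xy * H xy =
      1 / (2 * h) * ∫ z in (-h)..h, ∫ xy in sqM, H xy * u (xy.1, xy.2, z) := by
    rw [← integral_sqM_intervalIntegral_swap h (F := fun P z => H P * u (P.1, P.2, z))
      ((hH.comp continuous_fst).mul (hu.comp hc)), ← MeasureTheory.integral_const_mul]
    refine setIntegral_congr_fun measurableSet_sqM fun P _ => ?_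
    simp only [vertAvg, intervalIntegral.integral_const_mul]
    ring
  have hpos : 0 < 1 / (2 * h) := by positivity
  rw [e, abs_mul, abs_of_pos hpos]
  refine mul_le_mul_of_nonneg_left ?_ hpos.le
  have hle : -h ≤ h := by linarith
  refine (abs_integral_le_integral_abs hle).trans ?_
  rw [← intervalIntegral.integral_const_mul]
  have hcont := continuous_sqrt_rpow h1 h2 hq.le
  refine integral_mono_on hle ?_ ((continuous_const.mul hcont).intervalIntegrable _ _) fun z _ => ?_
  · refine (continuous_setIntegral_sqM (F := fun z P => H P * u (P.1, P.2, z)) ?_).abs.intervalIntegrable _ _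
    exact (hH.comp continuous_snd).mul (hu.comp (by fun_prop : Continuous fun p : ℝ × ℝ × ℝ => (p.2.1, p.2.2, p.1)))
  · refine (hbd z).trans (mul_le_mul_of_nonneg_left ?_ hK)
    refine rpow_le_rpow (integral_nonneg fun P => by positivity) ?_ (by positivity)
    refine integral_mono ((hu.comp (hz z)).abs.rpow_const fun _ => Or.inr hq.le).integrableOn_sqM
      ((((h1.comp (hz z)).pow 2).add ((h2.comp (hz z)).pow 2)).sqrt.rpow_const
        fun _ => Or.inr (by positivity)).integrableOn_sqM fun P => ?_
    have h0 : 0 ≤ v1 (P.1, P.2, z) ^ 2 + v2 (P.1, P.2, z) ^ 2 := by positivity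
    simp only
    rw [rpow_mul (sqrt_nonneg _), rpow_two, sq_sqrt h0]
    exact rpow_le_rpow (abs_nonneg _) (huv _) hq.le

/-- The pressure tested against trigonometric polynomials. -/
lemma exists_abs_integral_pressure_le {h : ℝ} (hh : 0 < h) {r q : ℝ} (hr : r.HolderConjugate q) :
    ∃ C > 0, ∀ v1 v2 ps1, Hyp15 h v1 v2 ps1 → ∀ L : List HeatMode,
      ∫ P in sqM, ps1 P * heat L 0 P ≤
        C * (∫ z in (-h)..h, (∫ xy in sqM,
          (√((v1 (xy.1, xy.2, z)) ^ 2 + (v2 (xy.1, xy.2, z)) ^ 2)) ^ (2 * q)) ^ (1 / q)) *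
        (∫ P in sqM, |heat L 0 P| ^ r) ^ (1 / r) := by
  obtain ⟨C, hC, hbd⟩ := exists_abs_integral_invLap_le hr
  refine ⟨4 * (1 / (2 * h)) * (C + 1), by positivity, fun v1 v2 ps1 H L => ?_⟩
  have heq := H.pressureEq
  obtain ⟨s1, s2, -, per1, per2, -, -, hmean⟩ := H
  have h1 : SmoothPer v1 := ⟨s1, per1⟩
  have h2 : SmoothPer v2 := ⟨s2, per2⟩
  have c1 := s1.continuous
  have c2 := s2.continuous
  have hcp := heq.perC1.cont
  have c := continuous_heat_time
  set M := ∫ z in (-h)..h, (∫ xy in sqM,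
    (√((v1 (xy.1, xy.2, z)) ^ 2 + (v2 (xy.1, xy.2, z)) ^ 2)) ^ (2 * q)) ^ (1 / q) with hM
  set A := (∫ P in sqM, |heat L 0 P| ^ r) ^ (1 / r) with hA
  have hA0 : 0 ≤ A := rpow_nonneg (integral_nonneg fun P => by positivity) _
  have hM0 : 0 ≤ M := integral_nonneg (by linarith) fun z _ =>
    rpow_nonneg (integral_nonneg fun P => by positivity) _
  have main : ∀ u : ℝ × ℝ × ℝ → ℝ, SmoothPer u → (∀ p, |u p| ≤ v1 p ^ 2 + v2 p ^ 2) →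
      ∀ D D', IsDir D → IsDir D' →
      |∫ P in sqM, vertAvg h u P * heat (((L.map invLap).map D).map D') 0 P| ≤
        1 / (2 * h) * ((C * A) * M) := fun u hu huv D D' hD hD' =>
    abs_integral_vertAvg_mul_le hh c1 c2 hu.smooth.continuous huv hr.symm.pos (c _ 0) (by positivity)
      fun z => by
        rw [mul_assoc]
        exact hbd D D' hD hD' L _ (hu.smooth.continuous.comp (by fun_prop)) fun x y => hu.per x y z
  have b11 := main _ (h1.mul h1) (fun p => by rw [abs_mul_self]; nlinarith [sq_nonneg (v2 p)])
    dx dx (Or.inl rfl) (Or.inl rfl)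
  have b12 := main _ (h1.mul h2) (fun p => by
    rw [abs_mul, ← sq_abs (v1 p), ← sq_abs (v2 p)]; nlinarith [sq_nonneg (|v1 p| - |v2 p|)])
    dx dy (Or.inl rfl) (Or.inr rfl)
  have b21 := main _ (h2.mul h1) (fun p => by
    rw [abs_mul, ← sq_abs (v1 p), ← sq_abs (v2 p)]; nlinarith [sq_nonneg (|v1 p| - |v2 p|)])
    dy dx (Or.inr rfl) (Or.inl rfl)
  have b22 := main _ (h2.mul h2) (fun p => by rw [abs_mul_self]; nlinarith [sq_nonneg (v1 p)])
    dy dy (Or.inr rfl) (Or.inr rfl)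
  have e0 : ∫ P in sqM, ps1 P * heat L 0 P =
      ∫ P in sqM, ps1 P * heat ((L.map invLap).map lap) 0 P := by
    have i1 : IntegrableOn (fun P => ps1 P * heat L 0 P) sqM := (hcp.mul (c _ 0)).integrableOn_sqM
    have i2 : IntegrableOn (fun P => ps1 P * ∫ Q in sqM, heat L 0 Q) sqM :=
      (hcp.mul continuous_const).integrableOn_sqM
    simp only [heat_invLap_lap, mul_sub]
    rw [integral_sub i1 i2, MeasureTheory.integral_mul_const, hmean, zero_mul, sub_zero]
  have k11 := ((h1.mul h1).perC1_vertAvg h).integral_dx_mul_heat ((L.map invLap).map dx)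
  have k12 := ((h1.mul h2).perC1_vertAvg h).integral_dy_mul_heat ((L.map invLap).map dx)
  have k21 := ((h2.mul h1).perC1_vertAvg h).integral_dx_mul_heat ((L.map invLap).map dy)
  have k22 := ((h2.mul h2).perC1_vertAvg h).integral_dy_mul_heat ((L.map invLap).map dy)
  have ci : ∀ {u : ℝ × ℝ × ℝ → ℝ}, SmoothPer u → ∀ N : List HeatMode,
      IntegrableOn (fun P => vertAvg h u P * heat N 0 P) sqM := fun hu N =>
    ((continuous_vertAvg h hu.smooth.continuous).mul (c N 0)).integrableOn_sqM
  rw [e0, heq.integral_mul_heat_lap]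
  simp only [add_mul]
  rw [integral_add (ci (h1.mul h1).dX _) (ci (h1.mul h2).dY _),
    integral_add (ci (h2.mul h1).dX _) (ci (h2.mul h2).dY _), k11, k12, k21, k22]
  have hfin : 0 ≤ 1 / (2 * h) * (A * M) := by positivity
  have := neg_abs_le (∫ P in sqM, vertAvg h (fun p => v1 p * v1 p) P * heat (((L.map invLap).map dx).map dx) 0 P)
  have := neg_abs_le (∫ P in sqM, vertAvg h (fun p => v1 p * v2 p) P * heat (((L.map invLap).map dx).map dy) 0 P)
  have := neg_abs_le (∫ P in sqM, vertAvg h (fun p => v2 p * v1 p) P * heat (((L.map invLap).map dy).map dx) 0 P)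
  have := neg_abs_le (∫ P in sqM, vertAvg h (fun p => v2 p * v2 p) P * heat (((L.map invLap).map dy).map dy) 0 P)
  linarith

/-- The odd power `|s|^a sign s`. -/
def oddPow (a s : ℝ) : ℝ := max s 0 ^ a - max (-s) 0 ^ a

lemma continuous_oddPow {a : ℝ} (ha : 0 ≤ a) : Continuous (oddPow a) :=
  ((continuous_id.max continuous_const).rpow_const fun _ => Or.inr ha).sub
    ((continuous_neg.max continuous_const).rpow_const fun _ => Or.inr ha)

lemma abs_oddPow {a : ℝ} (ha : 0 < a) (s : ℝ) : |oddPow a s| = |s| ^ a := by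
  rcases le_total 0 s with hs | hs
  · rw [oddPow, max_eq_left hs, max_eq_right (by linarith), zero_rpow ha.ne', sub_zero, abs_of_nonneg hs,
      abs_of_nonneg (by positivity)]
  · rw [oddPow, max_eq_right hs, max_eq_left (by linarith), zero_rpow ha.ne', zero_sub, abs_neg,
      abs_of_nonpos hs, abs_of_nonneg (rpow_nonneg (by linarith) _)]

lemma mul_oddPow {a : ℝ} (ha : 0 < a) (s : ℝ) : s * oddPow a s = |s| ^ (a + 1) := by
  rw [rpow_add_one' (abs_nonneg s) (by linarith)]
  rcases le_total 0 s with hs | hs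
  · rw [oddPow, max_eq_left hs, max_eq_right (by linarith), zero_rpow ha.ne', sub_zero, abs_of_nonneg hs]
    ring
  · rw [oddPow, max_eq_right hs, max_eq_left (by linarith), zero_rpow ha.ne', zero_sub,
      abs_of_nonpos hs]
    ring

/-- The dual characterization of the `L^q` norm, with trigonometric test functions. -/
lemma rpow_integral_le_of_forall_heat {r q : ℝ} (hr : r.HolderConjugate q) {p : ℝ × ℝ → ℝ}
    (hp : Continuous p) (hper : ∀ x y : ℝ, p (x + 1, y) = p (x, y) ∧ p (x, y + 1) = p (x, y)) {K : ℝ}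
    (hK : 0 ≤ K) (H : ∀ L : List HeatMode, ∫ P in sqM, p P * heat L 0 P ≤
      K * (∫ P in sqM, |heat L 0 P| ^ r) ^ (1 / r)) :
    (∫ P in sqM, |p P| ^ q) ^ (1 / q) ≤ K := by
  have hq := hr.symm.lt
  have hq1 : 0 < q - 1 := by linarith
  obtain ⟨L, B, hL, hB⟩ := exists_seq_heat (G := fun P => oddPow (q - 1) (p P))
    ((continuous_oddPow hq1.le).comp hp) fun x y => by simp only [(hper x y).1, (hper x y).2, and_self]
  have t1 := tendsto_integral_comp_heat hL hB (Φ := fun a => p a.1 * a.2)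
    ((hp.comp continuous_fst).mul continuous_snd)
  have t2 := tendsto_integral_comp_heat hL hB (Φ := fun a => |a.2| ^ r)
    (continuous_snd.abs.rpow_const fun _ => Or.inr hr.nonneg)
  have h1 := le_of_tendsto_of_tendsto' t1
    ((t2.rpow_const (Or.inr (one_div_nonneg.2 hr.nonneg))).const_mul K) fun n => H (L n)
  have e1 : ∀ P, p P * oddPow (q - 1) (p P) = |p P| ^ q := fun P => by
    rw [mul_oddPow hq1, sub_add_cancel]
  have e2 : ∀ P, |oddPow (q - 1) (p P)| ^ r = |p P| ^ q := fun P => by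
    rw [abs_oddPow hq1, ← rpow_mul (abs_nonneg _)]
    congr 1
    have := hr.mul_eq_add
    linarith
  simp only [e1, e2] at h1
  set X := ∫ P in sqM, |p P| ^ q with hX
  have hX0 : 0 ≤ X := integral_nonneg fun P => by positivity
  rcases hX0.eq_or_lt with h0 | h0
  · rw [← h0, zero_rpow (one_div_pos.2 hr.symm.pos).ne']
    exact hK
  · have h2 : X = X ^ (1 / q) * X ^ (1 / r) := by
      rw [← rpow_add h0]
      have := hr.inv_add_inv_eq_one
      simp only [one_div]
      rw [add_comm, this, rpow_one]
    nth_rewrite 1 [h2] at h1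
    exact le_of_mul_le_mul_right h1 (rpow_pos_of_pos h0 _)

lemma sq_vertAvg_le {h : ℝ} (hh : 0 < h) {g W : ℝ × ℝ × ℝ → ℝ} (hg : Continuous g)
    (hW : Continuous W) {c : ℝ} (hgW : ∀ p, g p ^ 2 ≤ c * W p) (P : ℝ × ℝ) :
    vertAvg h g P ^ 2 ≤ c * vertAvg h W P := by
  have hι : Continuous fun z : ℝ => (P.1, P.2, z) := by fun_prop
  have ig : IntervalIntegrable (fun z => g (P.1, P.2, z)) volume (-h) h :=
    (hg.comp hι).intervalIntegrable _ _
  have iW : IntervalIntegrable (fun z => W (P.1, P.2, z)) volume (-h) h :=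
    (hW.comp hι).intervalIntegrable _ _
  set m := vertAvg h g P with hm
  have hI : ∫ z in (-h)..h, g (P.1, P.2, z) = 2 * h * m := by
    rw [hm, vertAvg]
    field_simp
  have key : ∫ z in (-h)..h, (2 * m * g (P.1, P.2, z) - m ^ 2) ≤
      ∫ z in (-h)..h, c * W (P.1, P.2, z) := by
    refine intervalIntegral.integral_mono (by linarith)
      ((ig.const_mul _).sub intervalIntegrable_const) (iW.const_mul c) fun z => ?_
    have := hgW (P.1, P.2, z)
    have := sq_nonneg (g (P.1, P.2, z) - m)
    simp only
    linarith
  rw [intervalIntegral.integral_sub (ig.const_mul _) intervalIntegrable_const,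
    intervalIntegral.integral_const_mul, intervalIntegral.integral_const_mul, hI,
    intervalIntegral.integral_const, smul_eq_mul] at key
  have e : c * vertAvg h W P = 1 / (2 * h) * (c * ∫ z in (-h)..h, W (P.1, P.2, z)) := by
    rw [vertAvg]
    ring
  rw [e, one_div_mul_eq_div, le_div_iff₀ (by positivity)]
  linarith

lemma integral_vertAvg (h : ℝ) (hh : 0 < h) {W : ℝ × ℝ × ℝ → ℝ} (hW : Continuous W) :
    ∫ P in sqM, vertAvg h W P = 1 / (2 * h) * ∫ p in Omg h, W p := by
  have hι : Continuous fun p : (ℝ × ℝ) × ℝ => W (p.1.1, p.1.2, p.2) := hW.comp (by fun_prop)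
  have hint : IntegrableOn W (Omg h) :=
    (hW.continuousOn.integrableOn_compact
      (isCompact_Icc.prod (isCompact_Icc.prod isCompact_Icc))).mono_set
      (prod_mono Ioo_subset_Icc_self (prod_mono Ioo_subset_Icc_self Ioo_subset_Icc_self))
  simp only [vertAvg]
  rw [MeasureTheory.integral_const_mul,
    setIntegral_sqM (continuous_parametric_intervalIntegral_of_continuous' hι _ _)]
  congr 1
  rw [Omg, Measure.volume_eq_prod, setIntegral_prod _ hint, integral_of_le zero_le_one,
    integral_Ioc_eq_integral_Ioo]
  refine setIntegral_congr_fun measurableSet_Ioo fun x _ => ?_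
  have hx : IntegrableOn (fun q : ℝ × ℝ => W (x, q)) (Ioo 0 1 ×ˢ Ioo (-h) h) (volume.prod volume) :=
    ((hW.comp (by fun_prop : Continuous fun q : ℝ × ℝ => (x, q))).continuousOn.integrableOn_compact
      (isCompact_Icc.prod isCompact_Icc)).mono_set
      (prod_mono Ioo_subset_Icc_self Ioo_subset_Icc_self)
  simp only
  rw [Measure.volume_eq_prod, setIntegral_prod _ hx, integral_of_le zero_le_one,
    integral_Ioc_eq_integral_Ioo]
  refine setIntegral_congr_fun measurableSet_Ioo fun y _ => ?_
  rw [integral_of_le (by linarith), integral_Ioc_eq_integral_Ioo]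

lemma sq_mul_add_mul_le {a b c d A D : ℝ} (ha : a ^ 2 ≤ A) (hb : b ^ 2 ≤ A) (hc : c ^ 2 ≤ D)
    (hd : d ^ 2 ≤ D) : (a * c + b * d) ^ 2 ≤ 4 * (A * D) := by
  have h1 : a ^ 2 * c ^ 2 ≤ A * D := mul_le_mul ha hc (sq_nonneg c) ((sq_nonneg a).trans ha)
  have h2 : b ^ 2 * d ^ 2 ≤ A * D := mul_le_mul hb hd (sq_nonneg d) ((sq_nonneg b).trans hb)
  nlinarith [sq_nonneg (a * c - b * d)]

/-- The energy estimate for the surface pressure, with squared norms. -/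
lemma Hyp15.integral_grad_sq_le {h : ℝ} (hh : 0 < h) {v1 v2 : ℝ × ℝ × ℝ → ℝ} {ps1 : ℝ × ℝ → ℝ}
    (H : Hyp15 h v1 v2 ps1) :
    ∫ xy in sqM, (d2X ps1 xy ^ 2 + d2Y ps1 xy ^ 2) ≤ 16 / h * ∫ p in Omg h, (v1 p ^ 2 + v2 p ^ 2) *
      (dX v1 p ^ 2 + dY v1 p ^ 2 + dX v2 p ^ 2 + dY v2 p ^ 2) := by
  have heq := H.pressureEq
  obtain ⟨s1, s2, -, per1, per2, -⟩ := H
  have h1 : SmoothPer v1 := ⟨s1, per1⟩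
  have h2 : SmoothPer v2 := ⟨s2, per2⟩
  set W : ℝ × ℝ × ℝ → ℝ := fun p => (v1 p ^ 2 + v2 p ^ 2) *
    (dX v1 p ^ 2 + dY v1 p ^ 2 + dX v2 p ^ 2 + dY v2 p ^ 2)
  have hW : Continuous W :=
    ((s1.continuous.pow 2).add (s2.continuous.pow 2)).mul
      ((((h1.dX.smooth.continuous.pow 2).add (h1.dY.smooth.continuous.pow 2)).add
        (h2.dX.smooth.continuous.pow 2)).add (h2.dY.smooth.continuous.pow 2))
  have b11 := sq_vertAvg_le hh (h1.mul h1).dX.smooth.continuous hW (c := 4) fun p => by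
    rw [h1.dX_mul h1]
    apply sq_mul_add_mul_le <;> nlinarith only [sq_nonneg (v1 p), sq_nonneg (v2 p),
      sq_nonneg (dX v1 p), sq_nonneg (dX v2 p), sq_nonneg (dY v1 p), sq_nonneg (dY v2 p)]
  have b12 := sq_vertAvg_le hh (h1.mul h2).dY.smooth.continuous hW (c := 4) fun p => by
    rw [h1.dY_mul h2]
    apply sq_mul_add_mul_le <;> nlinarith only [sq_nonneg (v1 p), sq_nonneg (v2 p),
      sq_nonneg (dX v1 p), sq_nonneg (dX v2 p), sq_nonneg (dY v1 p), sq_nonneg (dY v2 p)]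
  have b21 := sq_vertAvg_le hh (h2.mul h1).dX.smooth.continuous hW (c := 4) fun p => by
    rw [h2.dX_mul h1]
    apply sq_mul_add_mul_le <;> nlinarith only [sq_nonneg (v1 p), sq_nonneg (v2 p),
      sq_nonneg (dX v1 p), sq_nonneg (dX v2 p), sq_nonneg (dY v1 p), sq_nonneg (dY v2 p)]
  have b22 := sq_vertAvg_le hh (h2.mul h2).dY.smooth.continuous hW (c := 4) fun p => by
    rw [h2.dY_mul h2]
    apply sq_mul_add_mul_le <;> nlinarith only [sq_nonneg (v1 p), sq_nonneg (v2 p),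
      sq_nonneg (dX v1 p), sq_nonneg (dX v2 p), sq_nonneg (dY v1 p), sq_nonneg (dY v2 p)]
  have c := fun {u : ℝ × ℝ × ℝ → ℝ} (hu : SmoothPer u) => continuous_vertAvg h hu.smooth.continuous
  calc _ ≤ _ := heq.integral_grad_sq_le
    _ ≤ ∫ P in sqM, 32 * vertAvg h W P := by
        refine integral_mono
          ((((c (h1.mul h1).dX).add (c (h1.mul h2).dY)).pow 2).add
            (((c (h2.mul h1).dX).add (c (h2.mul h2).dY)).pow 2)).integrableOn_sqM
          (continuous_const.mul (continuous_vertAvg h hW)).integrableOn_sqM fun P => ?_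
        have a11 := b11 P
        have a12 := b12 P
        have a21 := b21 P
        have a22 := b22 P
        simp only
        nlinarith only [a11, a12, a21, a22, add_sq_le (a := vertAvg h (dX fun p => v1 p * v1 p) P)
            (b := vertAvg h (dY fun p => v1 p * v2 p) P),
          add_sq_le (a := vertAvg h (dX fun p => v2 p * v1 p) P)
            (b := vertAvg h (dY fun p => v2 p * v2 p) P)]
    _ = 16 / h * ∫ p in Omg h, W p := by
        rw [MeasureTheory.integral_const_mul, integral_vertAvg h hh hW]
        field_simp
        ring

/-- Elliptic estimates for the surface pressure component `ps1`:
`‖ps1‖_{L^q(M)} ≤ C_q ∫ ‖v(·,z)‖_{L^{2q}(M)}² dz` and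
`‖∇_H ps1‖_{L²(M)} ≤ C ‖|v||∇_H v|‖_{L²(Ω)}`. -/
theorem stmt_15 (h : ℝ) (hh : 0 < h) :
    (∀ q : ℝ, 1 < q → ∃ C > 0, ∀ v1 v2 ps1, Hyp15 h v1 v2 ps1 →
      (∫ xy in sqM, |ps1 xy| ^ q) ^ (1 / q) ≤
        C * ∫ z in (-h)..h,
          (∫ xy in sqM,
            (Real.sqrt ((v1 (xy.1, xy.2, z)) ^ 2 + (v2 (xy.1, xy.2, z)) ^ 2)) ^ (2 * q)) ^
            (1 / q)) ∧
    (∃ C > 0, ∀ v1 v2 ps1, Hyp15 h v1 v2 ps1 →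
      (∫ xy in sqM, ((d2X ps1 xy) ^ 2 + (d2Y ps1 xy) ^ 2)) ^ ((1 : ℝ) / 2) ≤
        C * (∫ p in Omg h,
            ((v1 p) ^ 2 + (v2 p) ^ 2) *
              ((dX v1 p) ^ 2 + (dY v1 p) ^ 2 + (dX v2 p) ^ 2 + (dY v2 p) ^ 2)) ^
          ((1 : ℝ) / 2)) := by
  refine ⟨fun q hq => ?_, (16 / h) ^ ((1 : ℝ) / 2), by positivity, fun v1 v2 ps1 H => ?_⟩
  · obtain ⟨C, hC, hle⟩ := exists_abs_integral_pressure_le hh (Real.HolderConjugate.conjExponent hq).symm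
    refine ⟨C, hC, fun v1 v2 ps1 H => ?_⟩
    have hM := hle v1 v2 ps1 H
    obtain ⟨-, -, hp, -, -, hper, -, -⟩ := H
    refine rpow_integral_le_of_forall_heat (Real.HolderConjugate.conjExponent hq).symm hp.continuous hper
      (mul_nonneg hC.le (intervalIntegral.integral_nonneg (by linarith) fun z _ => ?_)) hM
    exact rpow_nonneg (integral_nonneg fun P => by positivity) _
  · rw [← mul_rpow (by positivity) (integral_nonneg fun p => by positivity)]
    exact rpow_le_rpow (integral_nonneg fun P => by positivity) (H.integral_grad_sq_le hh) (by norm_num)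
end
end

section
/- Let Ω ⊂ ℝ³ be a bounded domain, p > 3, λ > 0, and let F ∈ W^{1,p}(Ω) be periodic (on the torus Ω = (0,1)²×(−h,h)). Then ‖F‖_{L^∞(Ω)} ≤ C_{p,λ} · max{ 1, sup_{r ≥ 2} ‖F‖_{L^r(Ω)} / r^λ } · log^λ( ‖F‖_{W^{1,p}(Ω)} + e ), for a constant C_{p,λ} depending only on p, λ and Ω. -/
open MeasureTheory Real Set

noncomputable section

/-- The `L^r(Ω)` norm. -/
def Lnorm (h r : ℝ) (f : ℝ × ℝ × ℝ → ℝ) : ℝ := (∫ p in Omg h, |f p| ^ r) ^ (1 / r)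

section Morrey

variable {E : Type*} [NormedAddCommGroup E] [NormedSpace ℝ E]

/-- The fundamental theorem of calculus along a segment, as an inequality that needs no
integrability of the derivative. -/
lemma enorm_sub_le_lintegral_enorm_fderiv {F : E → ℝ} (hF : Differentiable ℝ F) (x v : E) :
    ‖F (x + v) - F x‖ₑ ≤ ∫⁻ t in Ioc (0 : ℝ) 1, ‖fderiv ℝ F (x + t • v)‖ₑ * ‖v‖ₑ := by
  have hd : ∀ t : ℝ, HasDerivAt (fun t : ℝ => F (x + t • v)) (fderiv ℝ F (x + t • v) v) t := by
    intro t
    have h1 : HasDerivAt (fun t : ℝ => x + t • v) v t := by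
      simpa using ((hasDerivAt_id t).smul_const v).const_add x
    exact (hF (x + t • v)).hasFDerivAt.comp_hasDerivAt t h1
  have hle : ∫⁻ t in Ioc (0 : ℝ) 1, ‖fderiv ℝ F (x + t • v) v‖ₑ ≤
      ∫⁻ t in Ioc (0 : ℝ) 1, ‖fderiv ℝ F (x + t • v)‖ₑ * ‖v‖ₑ :=
    lintegral_mono fun t => ContinuousLinearMap.le_opENorm _ _
  refine le_trans ?_ hle
  by_cases hi : IntervalIntegrable (fun t : ℝ => fderiv ℝ F (x + t • v) v) volume 0 1
  · have h2 := intervalIntegral.integral_eq_sub_of_hasDerivAt (fun t _ => hd t) hi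
    simp only [one_smul, zero_smul, add_zero] at h2
    rw [← h2, intervalIntegral.integral_of_le zero_le_one]
    exact enorm_integral_le_lintegral_enorm _
  · have hm : AEStronglyMeasurable (fun t : ℝ => fderiv ℝ F (x + t • v) v)
        (volume.restrict (Ioc 0 1)) := by
      have : (fun t : ℝ => fderiv ℝ F (x + t • v) v) = deriv (fun t : ℝ => F (x + t • v)) :=
        funext fun t => (hd t).deriv.symm
      rw [this]
      exact (measurable_deriv _).aestronglyMeasurable
    have h3 : ¬ HasFiniteIntegral (fun t : ℝ => fderiv ℝ F (x + t • v) v)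
        (volume.restrict (Ioc 0 1)) := fun h =>
      hi ((intervalIntegrable_iff_integrableOn_Ioc_of_le zero_le_one).2 ⟨hm, h⟩)
    rw [hasFiniteIntegral_iff_enorm, not_lt, top_le_iff] at h3
    rw [h3]
    exact le_top

variable [FiniteDimensional ℝ E] [MeasurableSpace E] [BorelSpace E]
  (μ : Measure E) [μ.IsAddHaarMeasure] {Ω : Set E}

lemma setLIntegral_comp_homothety_le (hΩ : MeasurableSet Ω) (hc : Convex ℝ Ω) {x : E}
    (hx : x ∈ Ω) {s : ℝ} (hs : 0 < s) (hs1 : s ≤ 1) {g : E → ENNReal} (hg : Measurable g) :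
    ∫⁻ w in Ω, g (x + s • (w - x)) ∂μ ≤
      ENNReal.ofReal ((s ^ Module.finrank ℝ E)⁻¹) * ∫⁻ w in Ω, g w ∂μ := by
  have hG : Measurable (Ω.indicator g) := hg.indicator hΩ
  calc ∫⁻ w in Ω, g (x + s • (w - x)) ∂μ
      = ∫⁻ w in Ω, Ω.indicator g (x + s • (w - x)) ∂μ := by
        refine setLIntegral_congr_fun hΩ fun w hw => ?_
        have : x + s • (w - x) ∈ Ω := hc.add_smul_sub_mem hx hw ⟨hs.le, hs1⟩
        simp only [indicator_of_mem this]
    _ ≤ ∫⁻ w, Ω.indicator g (x + s • (w - x)) ∂μ := setLIntegral_le_lintegral _ _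
    _ = ∫⁻ w, Ω.indicator g (x + s • w) ∂μ :=
        lintegral_sub_right_eq_self (fun w => Ω.indicator g (x + s • w)) x
    _ = ∫⁻ w, Ω.indicator g (x + w) ∂(Measure.map (s • ·) μ) := by
        rw [lintegral_map (f := fun w => Ω.indicator g (x + w)) (by fun_prop)
          (measurable_const_smul s)]
    _ = ENNReal.ofReal ((s ^ Module.finrank ℝ E)⁻¹) * ∫⁻ w, Ω.indicator g (x + w) ∂μ := by
        rw [Measure.map_addHaar_smul μ hs.ne', lintegral_smul_measure,
          abs_of_pos (by positivity), smul_eq_mul]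
    _ = ENNReal.ofReal ((s ^ Module.finrank ℝ E)⁻¹) * ∫⁻ w in Ω, g w ∂μ := by
        rw [lintegral_add_left_eq_self (Ω.indicator g) x, lintegral_indicator hΩ]

lemma setLIntegral_enorm_comp_homothety_le (hΩ : MeasurableSet Ω) (hc : Convex ℝ Ω) {x : E}
    (hx : x ∈ Ω) {s : ℝ} (hs : 0 < s) (hs1 : s ≤ 1) {f : E → ℝ} (hf : Measurable f)
    {q : ℝ} (hq : 1 ≤ q) :
    ∫⁻ w in Ω, ‖f (x + s • (w - x))‖ₑ ∂μ ≤
      ENNReal.ofReal (s ^ (-(Module.finrank ℝ E / q : ℝ))) *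
        eLpNorm f (ENNReal.ofReal q) (μ.restrict Ω) * μ Ω ^ (1 - 1 / q) := by
  have hq0 : 0 < q := by linarith
  have hq0' : ENNReal.ofReal q ≠ 0 := by simpa using hq0
  have hφ : Measurable fun w : E => x + s • (w - x) := by fun_prop
  rw [← eLpNorm_one_eq_lintegral_enorm (f := fun w => f (x + s • (w - x)))]
  have h1 := eLpNorm_le_eLpNorm_mul_rpow_measure_univ (μ := μ.restrict Ω)
    (p := 1) (q := ENNReal.ofReal q) (by simpa using hq)
    (hf.comp hφ).aestronglyMeasurable
  simp only [Function.comp_def, Measure.restrict_apply_univ, ENNReal.toReal_one, div_one,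
    ENNReal.toReal_ofReal hq0.le] at h1
  refine h1.trans ?_
  gcongr
  rw [eLpNorm_eq_lintegral_rpow_enorm_toReal hq0' ENNReal.ofReal_ne_top,
    eLpNorm_eq_lintegral_rpow_enorm_toReal hq0' ENNReal.ofReal_ne_top,
    ENNReal.toReal_ofReal hq0.le]
  have h2 := setLIntegral_comp_homothety_le μ hΩ hc hx hs hs1
    (g := fun w => ‖f w‖ₑ ^ q) (hf.enorm.pow_const q)
  calc _ ≤ _ := ENNReal.rpow_le_rpow h2 (by positivity)
    _ = _ := by
      rw [ENNReal.mul_rpow_of_nonneg _ _ (by positivity),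
        ENNReal.ofReal_rpow_of_pos (by positivity)]
      congr 2
      rw [← rpow_natCast, ← rpow_neg hs.le, ← rpow_mul hs.le]
      ring_nf

lemma lintegral_ofReal_mul_rpow_neg {δ a : ℝ} (hδ : 0 < δ) (ha : a < 1) :
    ∫⁻ t in Ioc (0 : ℝ) 1, ENNReal.ofReal ((t * δ) ^ (-a)) =
      ENNReal.ofReal (δ ^ (-a) / (1 - a)) := by
  have hi : IntervalIntegrable (fun t : ℝ => t ^ (-a)) volume 0 1 :=
    intervalIntegral.intervalIntegrable_rpow' (by linarith)
  have h1 : ∀ t ∈ Ioc (0 : ℝ) 1, (t * δ) ^ (-a) = t ^ (-a) * δ ^ (-a) := fun t ht =>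
    mul_rpow ht.1.le hδ.le
  rw [setLIntegral_congr_fun measurableSet_Ioc fun t ht => by rw [h1 t ht],
    ← ofReal_integral_eq_lintegral_ofReal, ← intervalIntegral.integral_of_le zero_le_one,
    intervalIntegral.integral_mul_const, integral_rpow (Or.inl (by linarith))]
  · rw [one_rpow, zero_rpow (by linarith)]
    congr 1
    rw [show -a + 1 = 1 - a by ring]
    ring
  · exact (((intervalIntegrable_iff_integrableOn_Ioc_of_le zero_le_one).1 hi).mul_const _)
  · filter_upwards [self_mem_ae_restrict measurableSet_Ioc] with t ht
    have := ht.1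
    simp only [Pi.zero_apply]
    positivity

/-- A Morrey type estimate on a convex set, with a free averaging scale `δ`. -/
lemma measure_mul_enorm_le_of_differentiable (hΩ : MeasurableSet Ω) (hc : Convex ℝ Ω)
    {F : E → ℝ} (hF : Differentiable ℝ F) {x : E} (hx : x ∈ Ω) {D : ℝ}
    (hD : ∀ w ∈ Ω, ‖w - x‖ ≤ D) {δ : ℝ} (hδ : 0 < δ) (hδ1 : δ ≤ 1) {r p : ℝ} (hr : 1 ≤ r)
    (hp1 : 1 ≤ p) (hp : Module.finrank ℝ E < p) :
    μ Ω * ‖F x‖ₑ ≤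
      ENNReal.ofReal (δ ^ (-(Module.finrank ℝ E / r : ℝ))) *
        eLpNorm F (ENNReal.ofReal r) (μ.restrict Ω) * μ Ω ^ (1 - 1 / r) +
      ENNReal.ofReal (δ * D) * (ENNReal.ofReal
        (δ ^ (-(Module.finrank ℝ E / p : ℝ)) / (1 - Module.finrank ℝ E / p)) *
        (eLpNorm (fun w => ‖fderiv ℝ F w‖) (ENNReal.ofReal p) (μ.restrict Ω) *
          μ Ω ^ (1 - 1 / p))) := by
  have hFm : Measurable F := hF.continuous.measurable
  have hgm : Measurable fun w => ‖fderiv ℝ F w‖ := (measurable_fderiv ℝ F).norm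
  have hpt : ∀ w ∈ Ω, ‖F x‖ₑ ≤ ‖F (x + δ • (w - x))‖ₑ +
      ENNReal.ofReal (δ * D) * ∫⁻ t in Ioc (0 : ℝ) 1, ‖fderiv ℝ F (x + (t * δ) • (w - x))‖ₑ := by
    intro w hw
    have h1 : ‖F x‖ₑ ≤ ‖F (x + δ • (w - x))‖ₑ + ‖F (x + δ • (w - x)) - F x‖ₑ := by
      have := enorm_sub_le (a := F (x + δ • (w - x))) (b := F (x + δ • (w - x)) - F x)
      simpa using this
    have hv : ‖δ • (w - x)‖ₑ ≤ ENNReal.ofReal (δ * D) := by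
      rw [← ofReal_norm]
      refine ENNReal.ofReal_le_ofReal ?_
      rw [norm_smul, Real.norm_of_nonneg hδ.le]
      exact mul_le_mul_of_nonneg_left (hD w hw) hδ.le
    refine h1.trans (add_le_add le_rfl ?_)
    refine (enorm_sub_le_lintegral_enorm_fderiv hF x (δ • (w - x))).trans ?_
    rw [lintegral_mul_const' _ _ enorm_ne_top, mul_comm]
    simp only [smul_smul]
    gcongr
  have hmeas : Measurable fun z : E × ℝ => ‖fderiv ℝ F (x + (z.2 * δ) • (z.1 - x))‖ₑ :=
    (measurable_fderiv ℝ F).enorm.comp (by fun_prop)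
  calc μ Ω * ‖F x‖ₑ = ∫⁻ _ in Ω, ‖F x‖ₑ ∂μ := by rw [setLIntegral_const, mul_comm]
    _ ≤ ∫⁻ w in Ω, (‖F (x + δ • (w - x))‖ₑ + ENNReal.ofReal (δ * D) *
          ∫⁻ t in Ioc (0 : ℝ) 1, ‖fderiv ℝ F (x + (t * δ) • (w - x))‖ₑ) ∂μ :=
        setLIntegral_mono' hΩ hpt
    _ = ∫⁻ w in Ω, ‖F (x + δ • (w - x))‖ₑ ∂μ + ENNReal.ofReal (δ * D) *
          ∫⁻ t in Ioc (0 : ℝ) 1, ∫⁻ w in Ω, ‖fderiv ℝ F (x + (t * δ) • (w - x))‖ₑ ∂μ := by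
        rw [lintegral_add_left (by fun_prop), lintegral_const_mul' _ _ ENNReal.ofReal_ne_top,
          lintegral_lintegral_swap hmeas.aemeasurable]
    _ ≤ _ := by
        gcongr
        · exact setLIntegral_enorm_comp_homothety_le μ hΩ hc hx hδ hδ1 hFm hr
        · rw [← lintegral_ofReal_mul_rpow_neg hδ ((div_lt_one (by linarith)).2 hp),
            ← lintegral_mul_const _ (by fun_prop)]
          refine setLIntegral_mono' measurableSet_Ioc fun t ht => ?_
          have := setLIntegral_enorm_comp_homothety_le μ hΩ hc hx (mul_pos ht.1 hδ)
            (mul_le_one₀ ht.2 hδ.le hδ1) hgm hp1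
          simpa only [enorm_norm, mul_assoc] using this

end Morrey

lemma measurableSet_Omg (h : ℝ) : MeasurableSet (Omg h) :=
  measurableSet_Ioo.prod (measurableSet_Ioo.prod measurableSet_Ioo)

lemma convex_Omg (h : ℝ) : Convex ℝ (Omg h) :=
  (convex_Ioo 0 1).prod ((convex_Ioo 0 1).prod (convex_Ioo (-h) h))

lemma volume_Omg (h : ℝ) : volume (Omg h) = ENNReal.ofReal (2 * h) := by
  rw [Omg, Measure.volume_eq_prod, Measure.prod_prod, Measure.volume_eq_prod, Measure.prod_prod]
  simp only [Real.volume_Ioo, sub_zero, ENNReal.ofReal_one, one_mul]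
  ring_nf

lemma norm_sub_le_of_mem_Omg {h : ℝ} (hh : 0 < h) {w x : ℝ × ℝ × ℝ} (hw : w ∈ Omg h)
    (hx : x ∈ Omg h) : ‖w - x‖ ≤ 1 + 2 * h := by
  obtain ⟨⟨a1, a2⟩, ⟨a3, a4⟩, a5, a6⟩ := hw
  obtain ⟨⟨b1, b2⟩, ⟨b3, b4⟩, b5, b6⟩ := hx
  simp only [Prod.norm_def, Prod.fst_sub, Prod.snd_sub, Real.norm_eq_abs]
  refine max_le ?_ (max_le ?_ ?_) <;> rw [abs_le] <;> constructor <;> linarith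

lemma exists_bound_on_Omg (h : ℝ) {F : ℝ × ℝ × ℝ → ℝ} (hF : Continuous F) :
    ∃ M : ℝ, 0 ≤ M ∧ ∀ w ∈ Omg h, ‖F w‖ ≤ M := by
  have hK : IsCompact (Icc (0 : ℝ) 1 ×ˢ Icc (0 : ℝ) 1 ×ˢ Icc (-h) h) :=
    isCompact_Icc.prod (isCompact_Icc.prod isCompact_Icc)
  obtain ⟨M, hM⟩ := hK.exists_bound_of_continuousOn hF.continuousOn
  refine ⟨max M 0, le_max_right _ _, fun w hw => (hM w ?_).trans (le_max_left _ _)⟩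
  exact prod_mono Ioo_subset_Icc_self (prod_mono Ioo_subset_Icc_self Ioo_subset_Icc_self) hw

lemma Lnorm_nonneg (h r : ℝ) (f : ℝ × ℝ × ℝ → ℝ) : 0 ≤ Lnorm h r f := by
  unfold Lnorm
  positivity

lemma eLpNorm_eq_ofReal_Lnorm {h r : ℝ} (hr : 0 < r) {f : ℝ × ℝ × ℝ → ℝ}
    (hf : MemLp f (ENNReal.ofReal r) (volume.restrict (Omg h))) :
    eLpNorm f (ENNReal.ofReal r) (volume.restrict (Omg h)) = ENNReal.ofReal (Lnorm h r f) := by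
  rw [hf.eLpNorm_eq_integral_rpow_norm (by simpa using hr) ENNReal.ofReal_ne_top,
    ENNReal.toReal_ofReal hr.le, Lnorm, one_div]
  simp only [Real.norm_eq_abs]

lemma memLp_of_bound_on_Omg {h M : ℝ} {F : ℝ × ℝ × ℝ → ℝ} (hF : Continuous F)
    (hM : ∀ w ∈ Omg h, ‖F w‖ ≤ M) (q : ENNReal) : MemLp F q (volume.restrict (Omg h)) := by
  have : IsFiniteMeasure (volume.restrict (Omg h)) :=
    ⟨by rw [Measure.restrict_apply_univ, volume_Omg]; exact ENNReal.ofReal_lt_top⟩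
  refine MemLp.of_bound hF.aestronglyMeasurable M ?_
  filter_upwards [self_mem_ae_restrict (measurableSet_Omg h)] with w hw using hM w hw

lemma rpow_le_max_one {V s : ℝ} (hV : 0 < V) (hs : 0 ≤ s) (hs1 : s ≤ 1) :
    V ^ s ≤ max 1 V := by
  rcases le_total V 1 with h | h
  · exact (rpow_le_one hV.le h hs).trans (le_max_left _ _)
  · exact ((rpow_le_rpow_of_exponent_le h hs1).trans_eq (rpow_one V)).trans (le_max_right _ _)

lemma bddAbove_Lnorm_div {h lam : ℝ} (hh : 0 < h) (hlam : 0 < lam) {F : ℝ × ℝ × ℝ → ℝ}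
    (hF : Continuous F) :
    BddAbove (range fun r : {r : ℝ // 2 ≤ r} => Lnorm h (r : ℝ) F / (r : ℝ) ^ lam) := by
  obtain ⟨M, hM0, hM⟩ := exists_bound_on_Omg h hF
  refine ⟨max 1 (2 * h) * M, ?_⟩
  rintro _ ⟨⟨r, hr⟩, rfl⟩
  have hr0 : 0 < r := by linarith
  refine (div_le_self (Lnorm_nonneg _ _ _) (one_le_rpow (by linarith) hlam.le)).trans ?_
  have h1 : eLpNorm F (ENNReal.ofReal r) (volume.restrict (Omg h)) ≤ _ :=
    eLpNorm_le_of_ae_bound (C := M) (by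
      filter_upwards [self_mem_ae_restrict (measurableSet_Omg h)] with w hw using hM w hw)
  rw [eLpNorm_eq_ofReal_Lnorm hr0 (memLp_of_bound_on_Omg hF hM _), Measure.restrict_apply_univ,
    volume_Omg, ENNReal.toReal_ofReal hr0.le, ENNReal.ofReal_rpow_of_pos (by positivity),
    ← ENNReal.ofReal_mul (by positivity), ENNReal.ofReal_le_ofReal_iff (by positivity)] at h1
  refine h1.trans (mul_le_mul_of_nonneg_right ?_ hM0)
  exact rpow_le_max_one (by positivity) (by positivity) (inv_le_one_of_one_le₀ (by linarith))

/-- Interpolation between `L^r` and `W^{1,p}` on the box, with a free averaging scale `δ`. -/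
lemma norm_le_Lnorm_add_Lnorm_fderiv {h p : ℝ} (hh : 0 < h) (hp : 3 < p)
    {F : ℝ × ℝ × ℝ → ℝ} (hF : Differentiable ℝ F)
    (hG : IntegrableOn (fun pt => ‖fderiv ℝ F pt‖ ^ p) (Omg h) volume)
    {x : ℝ × ℝ × ℝ} (hx : x ∈ Omg h) {δ : ℝ} (hδ : 0 < δ) (hδ1 : δ ≤ 1) {r : ℝ} (hr : 1 ≤ r) :
    ‖F x‖ ≤ max 1 (2 * h)⁻¹ * δ ^ (-(3 / r)) * Lnorm h r F +
      (1 + 2 * h) / (1 - 3 / p) * (2 * h) ^ (-(1 / p)) * δ ^ (1 - 3 / p) *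
        Lnorm h p (fun pt => ‖fderiv ℝ F pt‖) := by
  have hp0 : 0 < p := by linarith
  have hr0 : 0 < r := by linarith
  have hα : 0 < 1 - 3 / p := sub_pos.2 ((div_lt_one hp0).2 hp)
  obtain ⟨M, -, hM⟩ := exists_bound_on_Omg h hF.continuous
  have hgm : AEStronglyMeasurable (fun w => ‖fderiv ℝ F w‖) (volume.restrict (Omg h)) :=
    (measurable_fderiv ℝ F).norm.aestronglyMeasurable
  have hgL : MemLp (fun w => ‖fderiv ℝ F w‖) (ENNReal.ofReal p) (volume.restrict (Omg h)) := by
    rw [← integrable_norm_rpow_iff hgm (by simpa using hp0) ENNReal.ofReal_ne_top,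
      ENNReal.toReal_ofReal hp0.le]
    simp only [norm_norm]
    exact hG
  have hd : Module.finrank ℝ (ℝ × ℝ × ℝ) = 3 := by simp
  have : (volume : Measure (ℝ × ℝ)).IsAddHaarMeasure :=
    Measure.prod.instIsAddHaarMeasure volume volume
  have : (volume : Measure (ℝ × ℝ × ℝ)).IsAddHaarMeasure :=
    Measure.prod.instIsAddHaarMeasure volume volume
  have key := measure_mul_enorm_le_of_differentiable volume (measurableSet_Omg h) (convex_Omg h)
    hF hx (fun w hw => norm_sub_le_of_mem_Omg hh hw hx) hδ hδ1 hr (by linarith : 1 ≤ p)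
    (by rw [hd]; exact_mod_cast hp)
  have hL1 := Lnorm_nonneg h r F
  have hL2 := Lnorm_nonneg h p fun w => ‖fderiv ℝ F w‖
  rw [hd, eLpNorm_eq_ofReal_Lnorm hr0 (memLp_of_bound_on_Omg hF.continuous hM _),
    eLpNorm_eq_ofReal_Lnorm hp0 hgL, volume_Omg, ← ofReal_norm] at key
  push_cast at key
  set L1 := Lnorm h r F
  set L2 := Lnorm h p fun w => ‖fderiv ℝ F w‖
  have hV : 0 < 2 * h := by positivity
  rw [ENNReal.ofReal_rpow_of_pos hV, ENNReal.ofReal_rpow_of_pos hV,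
    ← ENNReal.ofReal_mul (by positivity), ← ENNReal.ofReal_mul (by positivity),
    ← ENNReal.ofReal_mul (by positivity), ← ENNReal.ofReal_mul (by positivity),
    ← ENNReal.ofReal_mul (by positivity), ← ENNReal.ofReal_mul (by positivity),
    ← ENNReal.ofReal_add (by positivity) (by positivity),
    ENNReal.ofReal_le_ofReal_iff (by positivity)] at key
  rw [sub_eq_add_neg 1 (1 / r), sub_eq_add_neg 1 (1 / p), rpow_add hV, rpow_add hV,
    rpow_one] at key
  have h1 : (2 * h) ^ (-(1 / r)) ≤ max 1 (2 * h)⁻¹ := by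
    rw [rpow_neg hV.le, ← inv_rpow hV.le]
    exact rpow_le_max_one (by positivity) (by positivity) ((div_le_one hr0).2 hr)
  have h2 : δ ^ (1 - 3 / p) = δ * δ ^ (-(3 / p)) := by
    rw [sub_eq_add_neg, rpow_add hδ, rpow_one]
  have h3 : ‖F x‖ ≤ (2 * h) ^ (-(1 / r)) * δ ^ (-(3 / r)) * L1 +
      (1 + 2 * h) / (1 - 3 / p) * (2 * h) ^ (-(1 / p)) * δ ^ (1 - 3 / p) * L2 := by
    refine le_of_mul_le_mul_left (key.trans_eq ?_) hV
    rw [h2]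
    ring
  refine h3.trans ?_
  gcongr

/-- Periodic-domain version of the 3D logarithmic Sobolev embedding inequality. -/
theorem stmt_18 (h : ℝ) (hh : 0 < h) (p lam : ℝ) (hp : 3 < p) (hlam : 0 < lam) :
    ∃ C > 0, ∀ F : ℝ × ℝ × ℝ → ℝ,
      Differentiable ℝ F →
      (∀ x y z : ℝ, F (x + 1, y, z) = F (x, y, z)) →
      (∀ x y z : ℝ, F (x, y + 1, z) = F (x, y, z)) →
      (∀ x y z : ℝ, F (x, y, z + 2 * h) = F (x, y, z)) →
      IntegrableOn (fun pt => |F pt| ^ p) (Omg h) volume →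
      IntegrableOn (fun pt => ‖fderiv ℝ F pt‖ ^ p) (Omg h) volume →
      (eLpNorm F ⊤ (volume.restrict (Omg h))).toReal ≤
        C * max 1 (⨆ r : {r : ℝ // 2 ≤ r}, Lnorm h (r : ℝ) F / (r : ℝ) ^ lam) *
          (Real.log (Lnorm h p F + Lnorm h p (fun pt => ‖fderiv ℝ F pt‖) +
            Real.exp 1)) ^ lam := by
  have hp0 : 0 < p := by linarith
  set α := 1 - 3 / p with hαdef
  have hα : 0 < α := sub_pos.2 ((div_lt_one hp0).2 hp)
  set A := max 1 (2 * h)⁻¹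
  set K := (1 + 2 * h) / α * (2 * h) ^ (-(1 / p))
  have hA : 0 < A := lt_max_of_lt_left one_pos
  have hK : 0 < K := by positivity
  refine ⟨A * rexp (3 / (2 * α)) * 2 ^ lam + K, by positivity, ?_⟩
  intro F hF _ _ _ _ hG
  set W1 := Lnorm h p F
  set W2 := Lnorm h p fun pt => ‖fderiv ℝ F pt‖ with hW2def
  have hW1 : 0 ≤ W1 := Lnorm_nonneg _ _ _
  have hW2 : 0 ≤ W2 := Lnorm_nonneg _ _ _
  set W := W1 + W2 + rexp 1
  have hW : 0 < W := by positivity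
  set L := Real.log W
  have hL : 1 ≤ L := by
    rw [Real.le_log_iff_exp_le hW]
    simp only [W]
    linarith
  set S := max 1 (⨆ r : {r : ℝ // 2 ≤ r}, Lnorm h (r : ℝ) F / (r : ℝ) ^ lam)
  have hS : 1 ≤ S := le_max_left _ _
  have hLl : 1 ≤ L ^ lam := one_le_rpow hL hlam.le
  have hLr : Lnorm h (2 * L) F ≤ S * (2 ^ lam * L ^ lam) := by
    rw [← mul_rpow zero_le_two (by linarith), ← div_le_iff₀ (by positivity)]
    exact (le_ciSup (bddAbove_Lnorm_div hh hlam hF.continuous)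
      (⟨2 * L, by linarith⟩ : {r : ℝ // 2 ≤ r})).trans (le_max_right _ _)
  have hpt : ∀ x ∈ Omg h, ‖F x‖ ≤
      (A * rexp (3 / (2 * α)) * 2 ^ lam + K) * S * L ^ lam := by
    intro x hx
    have key := norm_le_Lnorm_add_Lnorm_fderiv hh hp hF hG hx (δ := rexp (-(L / α)))
      (exp_pos _) (exp_le_one_iff.2 (neg_nonpos.2 (by positivity)))
      (r := 2 * L) (by linarith)
    rw [← exp_mul, ← exp_mul, ← hαdef, ← hW2def] at key
    have e1 : -(L / α) * -(3 / (2 * L)) = 3 / (2 * α) := by field_simp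
    have e2 : -(L / α) * α = -L := by field_simp
    have e3 : rexp (-L) * W2 ≤ 1 := by
      rw [exp_neg, Real.exp_log hW, inv_mul_le_one₀ hW]
      have := exp_pos 1
      simp only [W]
      linarith
    rw [e1, e2] at key
    calc ‖F x‖ ≤ A * rexp (3 / (2 * α)) * Lnorm h (2 * L) F + K * (rexp (-L) * W2) := by
          rw [← mul_assoc K]
          exact key
      _ ≤ A * rexp (3 / (2 * α)) * (S * (2 ^ lam * L ^ lam)) + K * (S * L ^ lam) := by
          refine add_le_add (by gcongr) (mul_le_mul_of_nonneg_left ?_ hK.le)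
          exact e3.trans (one_le_mul_of_one_le_of_one_le hS hLl)
      _ = _ := by ring
  rw [eLpNorm_exponent_top]
  refine ENNReal.toReal_le_of_le_ofReal (by positivity) (eLpNormEssSup_le_of_ae_bound ?_)
  filter_upwards [self_mem_ae_restrict (measurableSet_Omg h)] with x hx using hpt x hx
end
end
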